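/- arXiv:1404.3911 — 2 statements merged into one kernel-verified Lean document; each statement's English description precedes it below -/
import Mathlib

section
/- Let k be an algebraically closed field and let r ≥ 2 and d₁ ≥ d₂ ≥ ⋯ ≥ d_r ≥ 1 be integers such that it is not the case that both d₁ ≥ s and 2p − 3s > 0 (where s = d₂+⋯+d_r, D = Σ_{1≤i<j≤r} d_i d_j, p = D − d₁s, d = d₁+⋯+d_r). Then there exist nonzero homogeneous polynomials F₁,…,F_r, G₁,…,G_r ∈ k[x₀,x₁,x₂] with deg F_i = deg G_i = d_i such that dim_k (I_F ∩ I_G)_d = max{0, C(d+2,2) − 2D}. (This is the nondefective direction of the Main Theorem: for general [F],[G] ∈ X_{2,λ} the space (I_F ∩ I_G)_d has the expected dimension, so σ₂(X_{2,λ}) is not defective.) -/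
open MvPolynomial Finset

/-- The ideal `I_F = ⋂_{i<j} (F_i, F_j)` associated to a tuple of forms. -/
noncomputable def idealOfForms {k : Type*} [Field k] {r : ℕ}
    (F : Fin r → MvPolynomial (Fin 3) k) : Ideal (MvPolynomial (Fin 3) k) :=
  ⨅ (i : Fin r) (j : Fin r) (_ : i < j), Ideal.span {F i, F j}

/-- `dim_k (I)_n`, the dimension of the degree-`n` homogeneous part of the ideal `I`. -/
noncomputable def gradedDim {k : Type*} [Field k]
    (I : Ideal (MvPolynomial (Fin 3) k)) (n : ℕ) : ℕ :=
  Module.finrank k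
    ↥(Submodule.restrictScalars k I ⊓ homogeneousSubmodule (Fin 3) k n)

/-- `D = Σ_{1 ≤ i < j ≤ r} d_i d_j`. -/
def Dval {r : ℕ} (d : Fin r → ℕ) : ℕ :=
  ∑ q ∈ univ.filter (fun q : Fin r × Fin r => q.1 < q.2), d q.1 * d q.2

/-- `s = d_2 + ⋯ + d_r`. -/
def sval {r : ℕ} (d : Fin r → ℕ) : ℕ :=
  ∑ i ∈ univ.filter (fun i : Fin r => i.val ≠ 0), d i

/-- `p = Σ_{2 ≤ i < j ≤ r} d_i d_j = D - d_1 s`. -/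
def pval {r : ℕ} (d : Fin r → ℕ) : ℕ :=
  ∑ q ∈ univ.filter (fun q : Fin r × Fin r => q.1 < q.2 ∧ q.1.val ≠ 0), d q.1 * d q.2

section IndependentConditions

open scoped Matrix

variable {k : Type*} [Field k]

/-- The linear form with coefficient vector `v`. -/
noncomputable def linForm (v : Fin 3 → k) : MvPolynomial (Fin 3) k :=
  ∑ i, C (v i) * X i

theorem eval_linForm (v p : Fin 3 → k) : eval p (linForm v) = v ⬝ᵥ p := by
  simp [linForm, dotProduct]

theorem isHomogeneous_linForm (v : Fin 3 → k) : (linForm v).IsHomogeneous 1 :=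
  IsHomogeneous.sum _ _ _ fun i _ => isHomogeneous_C_mul_X _ i

theorem linForm_ne_zero {v p : Fin 3 → k} (h : v ⬝ᵥ p ≠ 0) : linForm v ≠ 0 := by
  rintro h0
  rw [← eval_linForm, h0, map_zero] at h
  exact h rfl

theorem MvPolynomial.IsHomogeneous.eval_smul {σ : Type*} {f : MvPolynomial σ k} {n : ℕ}
    (hf : f.IsHomogeneous n) (c : k) (p : σ → k) :
    eval (c • p) f = c ^ n * eval p f := by
  simp only [eval_eq, Finset.mul_sum]
  refine Finset.sum_congr rfl fun d hd => ?_
  have : c ^ n = ∏ i ∈ d.support, c ^ d i := by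
    rw [Finset.prod_pow_eq_pow_sum, hf.degree_eq_sum_deg_support hd]
  simp only [Pi.smul_apply, smul_eq_mul, mul_pow, Finset.prod_mul_distrib, this]
  ring

theorem finrank_homogeneousSubmodule (n : ℕ) :
    Module.finrank k (homogeneousSubmodule (Fin 3) k n) = (n + 2).choose 2 := by
  have hS : {d : Fin 3 →₀ ℕ | d.degree = n} =
      ↑(Finset.finsuppAntidiag (Finset.univ : Finset (Fin 3)) n) := by
    ext d
    simp [Finsupp.degree_eq_sum]
  rw [homogeneousSubmodule_eq_finsupp_supported, hS,
    (AddMonoidAlgebra.supportedEquivFinsupp _).finrank_eq]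
  simp [Finset.card_finsuppAntidiag_nat_eq_choose]
  rw [Nat.add_comm, Nat.choose_symm_add]

instance finite_homogeneousSubmodule (n : ℕ) :
    Module.Finite k (homogeneousSubmodule (Fin 3) k n) :=
  Module.finite_of_finrank_pos (by
    rw [finrank_homogeneousSubmodule]; exact Nat.choose_pos (by omega))

/-- The evaluation map of degree `n` forms at the points `P t`. -/
noncomputable def evalForms (n : ℕ) {T : Type*} (P : T → Fin 3 → k) :
    homogeneousSubmodule (Fin 3) k n →ₗ[k] T → k :=
  LinearMap.pi fun t => (aeval (P t)).toLinearMap ∘ₗ (homogeneousSubmodule (Fin 3) k n).subtype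

@[simp]
theorem evalForms_apply {n : ℕ} {T : Type*} {P : T → Fin 3 → k}
    (f : homogeneousSubmodule (Fin 3) k n) (t : T) :
    evalForms n P f t = eval (P t) (f : MvPolynomial (Fin 3) k) := by
  simp [evalForms, aeval_eq_eval]

/-- The points `P t` of the plane impose independent conditions on forms of degree `n`:
there is a family of forms dual to the evaluations. -/
def ImposesIndependent (n : ℕ) {T : Type*} (P : T → Fin 3 → k) : Prop :=
  ∃ g : T → MvPolynomial (Fin 3) k, (∀ i, (g i).IsHomogeneous n) ∧
    (∀ i, eval (P i) (g i) = 1) ∧ ∀ i j, i ≠ j → eval (P j) (g i) = 0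

namespace ImposesIndependent

variable {n : ℕ} {T : Type*} {P : T → Fin 3 → k}

theorem of_det [Fintype T] [DecidableEq T] (f : T → MvPolynomial (Fin 3) k)
    (hf : ∀ j, (f j).IsHomogeneous n)
    (hdet : (Matrix.of fun i j => eval (P i) (f j)).det ≠ 0) : ImposesIndependent n P := by
  set M : Matrix T T k := Matrix.of fun i j => eval (P i) (f j) with hM
  have key : ∀ i l, eval (P l) (∑ j, C (M⁻¹ j i) * f j) = (1 : Matrix T T k) l i := by
    intro i l
    rw [← Matrix.mul_nonsing_inv M (isUnit_iff_ne_zero.2 hdet), Matrix.mul_apply]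
    simp [hM, mul_comm]
  refine ⟨fun i => ∑ j, C (M⁻¹ j i) * f j, fun i => IsHomogeneous.sum _ _ _ fun j _ =>
    (hf j).C_mul _, fun i => ?_, fun i j hij => ?_⟩
  · rw [key, Matrix.one_apply_eq]
  · rw [key, Matrix.one_apply_ne hij.symm]

theorem smul (h : ImposesIndependent n P) {u : T → k} (hu : ∀ t, u t ≠ 0) :
    ImposesIndependent n fun t => u t • P t := by
  obtain ⟨g, hg, h1, h0⟩ := h
  refine ⟨fun t => C ((u t ^ n)⁻¹) * g t, fun t => (hg t).C_mul _, fun t => ?_,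
    fun t t' htt' => ?_⟩
  · simp [(hg t).eval_smul, h1, hu]
  · simp [(hg t).eval_smul, h0 t t' htt']

theorem comp (h : ImposesIndependent n P) {U : Type*} {e : U → T} (he : e.Injective) :
    ImposesIndependent n (P ∘ e) := by
  obtain ⟨g, hg, h1, h0⟩ := h
  exact ⟨g ∘ e, fun i => hg _, fun i => h1 _, fun i j hij => h0 _ _ (he.ne hij)⟩

theorem ne_smul (h : ImposesIndependent n P) {i j : T} (hij : i ≠ j) (c : k) :
    P i ≠ c • P j := by
  obtain ⟨g, hg, h1, h0⟩ := h
  intro hP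
  have := h1 i
  rw [hP, (hg i).eval_smul, h0 i j hij, mul_zero] at this
  exact zero_ne_one this

theorem sumElim_unit (h : ImposesIndependent n P) {Q : Fin 3 → k} {f : MvPolynomial (Fin 3) k}
    (hf : f.IsHomogeneous n) (hP : ∀ t, eval (P t) f = 0) (hQ : eval Q f ≠ 0) :
    ImposesIndependent n (Sum.elim P fun _ : Unit => Q) := by
  obtain ⟨g, hg, h1, h0⟩ := h
  refine ⟨Sum.elim (fun t => g t - C (eval Q (g t) / eval Q f) * f)
    fun _ => C ((eval Q f)⁻¹) * f, ?_, ?_, ?_⟩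
  · rintro (t | t)
    · exact (hg t).sub (hf.C_mul _)
    · exact hf.C_mul _
  · rintro (t | t)
    · simp [hP, h1]
    · simp [hQ]
  · rintro (t | t) (t' | t') htt'
    · simpa [hP] using h0 t t' (by simpa using htt')
    · simp [hQ]
    · simp [hP]
    · simp at htt'

theorem range_evalForms [Finite T] (h : ImposesIndependent n P) :
    LinearMap.range (evalForms n P) = ⊤ := by
  classical
  have := Fintype.ofFinite T
  obtain ⟨g, hg, h1, h0⟩ := h
  rw [LinearMap.range_eq_top]
  intro c
  refine ⟨∑ t, c t • ⟨g t, hg t⟩, ?_⟩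
  ext t
  rw [evalForms_apply]
  simp only [AddSubmonoidClass.coe_finsetSum, SetLike.val_smul, map_sum, smul_eval]
  rw [Finset.sum_eq_single t (fun i _ hi => by rw [h0 i t hi, mul_zero]) (by simp), h1, mul_one]

theorem finrank_ker [Fintype T] (h : ImposesIndependent n P) :
    Module.finrank k (LinearMap.ker (evalForms n P)) + Fintype.card T = (n + 2).choose 2 := by
  have := (evalForms n P).finrank_range_add_finrank_ker
  rw [h.range_evalForms, finrank_top, finrank_homogeneousSubmodule,
    Module.finrank_fintype_fun_eq_card] at this
  omega

end ImposesIndependent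

theorem exists_form_vanishing {n : ℕ} {T : Type*} [Fintype T] (P : T → Fin 3 → k)
    (h : Fintype.card T < (n + 2).choose 2) :
    ∃ f : MvPolynomial (Fin 3) k, f ≠ 0 ∧ f.IsHomogeneous n ∧ ∀ t, eval (P t) f = 0 := by
  have hker := LinearMap.ker_ne_bot_of_finrank_lt (f := evalForms n P) (by
    rwa [finrank_homogeneousSubmodule, Module.finrank_fintype_fun_eq_card])
  obtain ⟨f, hf, hf0⟩ := Submodule.exists_mem_ne_zero_of_ne_bot hker
  refine ⟨f, by simpa using hf0, f.2, fun t => ?_⟩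
  rw [← evalForms_apply, LinearMap.mem_ker.1 hf, Pi.zero_apply]

theorem exists_dotProduct_ne_zero {v : Fin 3 → k} (hv : v ≠ 0) : ∃ u, u ⬝ᵥ v ≠ 0 := by
  by_contra! h
  exact hv (dotProduct_eq_zero v fun w => by rw [dotProduct_comm]; exact h w)

/-- At most `n + 1` distinct points impose independent conditions on forms of degree `n`. -/
theorem imposesIndependent_of_card_le {n : ℕ} {T : Type*} [Fintype T] {w : T → Fin 3 → k}
    (h0 : ∀ i, w i ≠ 0) (hw : ∀ i j, i ≠ j → w i ⨯₃ w j ≠ 0) (hn : Fintype.card T ≤ n + 1) :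
    ImposesIndependent n w := by
  classical
  have hsep : ∀ i j, ∃ v, i ≠ j → v ⬝ᵥ w j = 0 ∧ v ⬝ᵥ w i ≠ 0 := by
    intro i j
    by_cases hij : i = j
    · exact ⟨0, fun h => (h hij).elim⟩
    · obtain ⟨u, hu⟩ := exists_dotProduct_ne_zero (hw i j hij)
      refine ⟨w j ⨯₃ u, fun _ => ⟨?_, ?_⟩⟩
      · rw [dotProduct_comm, dot_self_cross]
      · rwa [dotProduct_comm, triple_product_permutation, triple_product_permutation]
  choose v hv using hsep
  choose u hu using fun i => exists_dotProduct_ne_zero (h0 i)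
  let F : T → MvPolynomial (Fin 3) k := fun i =>
    (∏ j ∈ univ.erase i, linForm (v i j)) * linForm (u i) ^ (n + 1 - Fintype.card T)
  have hF1 : ∀ i, eval (w i) (F i) ≠ 0 := by
    intro i
    simp only [F, map_mul, map_prod, map_pow, eval_linForm]
    exact mul_ne_zero (Finset.prod_ne_zero_iff.2 fun j hj =>
      (hv i j (Finset.ne_of_mem_erase hj).symm).2) (pow_ne_zero _ (hu i))
  refine ⟨fun i => C ((eval (w i) (F i))⁻¹) * F i, fun i => IsHomogeneous.C_mul ?_ _,
    fun i => by simp [hF1], fun i j hij => ?_⟩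
  · have h1 := IsHomogeneous.prod (univ.erase i) (fun j => linForm (v i j)) (fun _ => 1)
      fun j _ => isHomogeneous_linForm _
    have h2 := (isHomogeneous_linForm (u i)).pow (n + 1 - Fintype.card T)
    convert h1.mul h2 using 1
    have : 0 < Fintype.card T := Fintype.card_pos_iff.2 ⟨i⟩
    simp [Finset.card_erase_of_mem]
    omega
  · have : eval (w j) (F i) = 0 := by
      simp only [F, map_mul, map_prod, map_pow, eval_linForm]
      rw [Finset.prod_eq_zero (Finset.mem_erase.2 ⟨hij.symm, mem_univ j⟩) (hv i j hij).1, zero_mul]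
    rw [map_mul, this, mul_zero]

end IndependentConditions

section Degeneration

open scoped Matrix

variable {k : Type*} [Field k]

/-- The restriction of a form to the parametrized line `s ↦ p + s q`. -/
noncomputable def alongLine (p q : Fin 3 → k) : MvPolynomial (Fin 3) k →ₐ[k] Polynomial k :=
  aeval fun i => Polynomial.C (p i) + Polynomial.C (q i) * Polynomial.X

theorem eval_alongLine (p q : Fin 3 → k) (f : MvPolynomial (Fin 3) k) (s : k) :
    (alongLine p q f).eval s = eval (p + s • q) f := by
  have : (Polynomial.aeval s).comp (alongLine p q) = aeval (p + s • q) := by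
    ext i
    simp [alongLine, mul_comm s]
  have h := DFunLike.congr_fun this f
  simpa [aeval_eq_eval] using h

theorem alongLine_zero (p : Fin 3 → k) (f : MvPolynomial (Fin 3) k) :
    alongLine p 0 f = Polynomial.C (eval p f) := by
  have : alongLine p 0 = Polynomial.CAlgHom.comp (aeval p) := by
    ext i
    simp [alongLine]
  rw [this]
  simp [aeval_eq_eval]

theorem alongLine_linForm (v p q : Fin 3 → k) :
    alongLine p q (linForm v) = Polynomial.C (v ⬝ᵥ p) + Polynomial.C (v ⬝ᵥ q) * Polynomial.X := by
  simp only [linForm, alongLine, map_sum, map_mul, aeval_X, dotProduct]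
  simp [mul_add, Finset.sum_add_distrib, Finset.sum_mul, mul_assoc,
    Polynomial.C_eq_algebraMap]

/-- A left kernel all of whose vectors are divisible by `X` is trivial. -/
theorem Matrix.det_ne_zero_of_forall_X_dvd {J : Type*} [Fintype J] [DecidableEq J]
    (A : Matrix J J (Polynomial k))
    (h : ∀ c : J → Polynomial k, c ᵥ* A = 0 → ∀ i, (c i).coeff 0 = 0) : A.det ≠ 0 := by
  rw [Ne, ← Matrix.exists_vecMul_eq_zero_iff]
  rintro ⟨c, hc0, hc⟩
  have key : ∀ m : ℕ, ∃ c' : J → Polynomial k, c' ᵥ* A = 0 ∧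
      c = (Polynomial.X ^ m : Polynomial k) • c' := by
    intro m
    induction m with
    | zero => exact ⟨c, hc, by simp⟩
    | succ m ih =>
      obtain ⟨c', hc', rfl⟩ := ih
      choose c'' hc'' using fun i => Polynomial.X_dvd_iff.2 (h c' hc' i)
      have hcc : c' = (Polynomial.X : Polynomial k) • c'' := funext fun i => by simp [hc'' i]
      refine ⟨c'', ?_, by rw [pow_succ, mul_smul, ← hcc]⟩
      rw [hcc, Matrix.smul_vecMul] at hc'
      exact (smul_eq_zero.1 hc').resolve_left Polynomial.X_ne_zero
  obtain ⟨i, hi⟩ := Function.ne_iff.1 hc0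
  obtain ⟨c', -, hc'⟩ := key ((c i).natDegree + 1)
  have hi' : c i = Polynomial.X ^ ((c i).natDegree + 1) * c' i := congrFun hc' i
  have hdvd : Polynomial.X ^ ((c i).natDegree + 1) ∣ c i := ⟨_, hi'⟩
  have := Polynomial.natDegree_le_of_dvd hdvd hi
  rw [Polynomial.natDegree_X_pow] at this
  omega

/-- Adding a line `ℓ` to a configuration: residual points `z`, points `w` on `ℓ`, and, over some
of the points of `ℓ`, further points approaching `ℓ` transversally, whose limits are required to
impose additional conditions on the residual system. -/
theorem exists_imposesIndependent_of_residual [Infinite k] {n : ℕ} {T W B : Type*}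
    [Fintype T] [Fintype W] [Fintype B]
    {l : Fin 3 → k} {z : T → Fin 3 → k} {w q : W → Fin 3 → k} {π : B → W} {c : B → k}
    {q' : B → Fin 3 → k}
    (hz : ∀ t, l ⬝ᵥ z t ≠ 0)
    (hres : ImposesIndependent n (Sum.elim z (w ∘ π)))
    (hlw : ∀ i, l ⬝ᵥ w i = 0) (hw : ImposesIndependent (n + 1) w)
    (hq : ∀ b, q (π b) = 0) (hc : ∀ b, c b ≠ 0)
    (hq' : ∀ b, l ⬝ᵥ q' b ≠ 0) :
    ∃ s : k, ImposesIndependent (n + 1)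
      (Sum.elim z (Sum.elim (fun i => w i + s • q i) fun b => c b • w (π b) + s • q' b)) := by
  classical
  obtain ⟨g, hg, hg1, hg0⟩ := hres
  obtain ⟨h, hh, hh1, hh0⟩ := hw
  let p₀ : T ⊕ (W ⊕ B) → Fin 3 → k := Sum.elim z (Sum.elim w fun b => c b • w (π b))
  let p₁ : T ⊕ (W ⊕ B) → Fin 3 → k := Sum.elim 0 (Sum.elim q q')
  let f : T ⊕ (W ⊕ B) → MvPolynomial (Fin 3) k :=
    Sum.elim (fun t => linForm l * g (.inl t)) (Sum.elim h fun b => linForm l * g (.inr b))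
  have hf : ∀ j, (f j).IsHomogeneous (n + 1) := by
    rintro (t | i | b)
    · exact add_comm 1 n ▸ (isHomogeneous_linForm l).mul (hg _)
    · exact hh i
    · exact add_comm 1 n ▸ (isHomogeneous_linForm l).mul (hg _)
  let A : Matrix (T ⊕ (W ⊕ B)) (T ⊕ (W ⊕ B)) (Polynomial k) :=
    Matrix.of fun i j => alongLine (p₀ i) (p₁ i) (f j)
  have hlwπ : ∀ b, l ⬝ᵥ (c b • w (π b)) = 0 := fun b => by rw [dotProduct_smul, hlw, smul_zero]
  have hA : A.det ≠ 0 := by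
    refine A.det_ne_zero_of_forall_X_dvd fun a ha => ?_
    have hcol : ∀ j, ∑ t, a (.inl t) * alongLine (z t) 0 (f j) +
        (∑ i, a (.inr (.inl i)) * alongLine (w i) (q i) (f j) +
          ∑ b, a (.inr (.inr b)) * alongLine (c b • w (π b)) (q' b) (f j)) = 0 := by
      intro j
      have := congrFun ha j
      simpa [Matrix.vecMul, dotProduct, A, p₀, p₁, Fintype.sum_sum_type] using this
    have hcol' : ∀ j : T ⊕ B, ∑ t, a (.inl t) * Polynomial.C ((l ⬝ᵥ z t) * eval (z t) (g j)) +
        Polynomial.X * (∑ i, a (.inr (.inl i)) * Polynomial.C (l ⬝ᵥ q i) *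
            alongLine (w i) (q i) (g j) +
          ∑ b, a (.inr (.inr b)) * Polynomial.C (l ⬝ᵥ q' b) *
            alongLine (c b • w (π b)) (q' b) (g j)) = 0 := by
      intro j
      have : f (Sum.elim Sum.inl (Sum.inr ∘ Sum.inr) j) = linForm l * g j := by
        rcases j with j | j <;> rfl
      rw [← hcol (Sum.elim Sum.inl (Sum.inr ∘ Sum.inr) j), this]
      simp only [map_mul, alongLine_linForm, hlw, hlwπ, alongLine_zero, dotProduct_zero, map_zero,
        zero_mul, add_zero, zero_add, mul_add, Finset.mul_sum]
      refine congrArg₂ (· + ·) ?_ (congrArg₂ (· + ·) ?_ ?_) <;>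
        exact Finset.sum_congr rfl fun _ _ => by ring
    have hT : ∀ t, (a (.inl t)).coeff 0 = 0 := by
      intro t
      have := congrArg (Polynomial.eval 0) (hcol' (.inl t))
      simp only [Polynomial.eval_add, Polynomial.eval_mul, Polynomial.eval_X, zero_mul, add_zero,
        Polynomial.eval_finsetSum, Polynomial.eval_C, Polynomial.eval_zero] at this
      rw [Finset.sum_eq_single t (fun t' _ ht' => by
        rw [show eval (z t') (g (.inl t)) = 0 from hg0 (.inl t) (.inl t') (by simpa using ht'.symm)]
        simp) (by simp), show eval (z t) (g (.inl t)) = 1 from hg1 (.inl t), mul_one] at this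
      rw [Polynomial.coeff_zero_eq_eval_zero]
      exact (mul_eq_zero.1 this).resolve_right (hz t)
    have hW : ∀ i, (a (.inr (.inl i))).coeff 0 +
        ∑ b, (a (.inr (.inr b))).coeff 0 * (if π b = i then c b ^ (n + 1) else 0) = 0 := by
      intro i
      have := congrArg (Polynomial.eval 0) (hcol (.inr (.inl i)))
      simp only [Polynomial.eval_add, Polynomial.eval_mul, Polynomial.eval_zero, eval_alongLine,
        Polynomial.eval_finsetSum, zero_smul, add_zero, ← Polynomial.coeff_zero_eq_eval_zero,
        hT, zero_mul, Finset.sum_const_zero, zero_add] at this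
      refine Eq.trans ?_ this
      have hfi : f (.inr (.inl i)) = h i := rfl
      congr 1
      · rw [Finset.sum_eq_single i (fun i' _ hi' => by rw [hfi, hh0 i i' hi'.symm, mul_zero])
          (by simp), hfi, hh1, mul_one]
      · refine Finset.sum_congr rfl fun b _ => ?_
        rw [hfi, (hh i).eval_smul]
        split_ifs with hb
        · rw [hb, hh1, mul_one]
        · rw [hh0 i _ (Ne.symm hb), mul_zero, mul_zero, mul_zero]
    have hW' : ∀ i, i ∉ Set.range π → (a (.inr (.inl i))).coeff 0 = 0 := by
      intro i hi
      have := hW i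
      rwa [Finset.sum_eq_zero fun b _ => by rw [if_neg fun hb => hi ⟨b, hb⟩, mul_zero], add_zero]
        at this
    have hB : ∀ b, (a (.inr (.inr b))).coeff 0 = 0 := by
      intro b
      have hb := hcol' (.inr b)
      rw [Finset.sum_eq_zero fun t _ => by
        rw [show eval (z t) (g (.inr b)) = 0 from hg0 (.inr b) (.inl t) (by simp)]; simp, zero_add]
        at hb
      have := congrArg (Polynomial.eval 0) ((mul_eq_zero.1 hb).resolve_left Polynomial.X_ne_zero)
      simp only [Polynomial.eval_add, Polynomial.eval_mul, Polynomial.eval_zero, eval_alongLine,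
        Polynomial.eval_finsetSum, zero_smul, add_zero, ← Polynomial.coeff_zero_eq_eval_zero,
        Polynomial.coeff_C_zero] at this
      rw [Finset.sum_eq_zero, zero_add, Finset.sum_eq_single b _ (by simp), (hg _).eval_smul,
        show eval (w (π b)) (g (.inr b)) = 1 from hg1 (.inr b), mul_one] at this
      · exact (mul_eq_zero.1 ((mul_eq_zero.1 this).resolve_right
          (pow_ne_zero _ (hc b)))).resolve_right (hq' b)
      · intro b' _ hb'
        rw [(hg _).eval_smul, show eval (w (π b')) (g (.inr b)) = 0 from
          hg0 (.inr b) (.inr b') (by simpa using hb'.symm)]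
        simp
      · intro i _
        by_cases hi : i ∈ Set.range π
        · obtain ⟨b', rfl⟩ := hi
          simp [hq]
        · simp [hW' i hi]
    rintro (t | i | b)
    · exact hT t
    · simpa [hB] using hW i
    · exact hB b
  obtain ⟨s, hs⟩ : ∃ s, A.det.eval s ≠ 0 := by
    by_contra! hs
    exact hA (Polynomial.funext fun s => by simp [hs s])
  have hpt : Sum.elim z (Sum.elim (fun i => w i + s • q i) fun b => c b • w (π b) + s • q' b) =
      fun i => p₀ i + s • p₁ i := by
    ext (t | i | b) <;> simp [p₀, p₁]
  refine ⟨s, ImposesIndependent.of_det f hf ?_⟩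
  convert hs using 1
  rw [← Polynomial.coe_evalRingHom, RingHom.map_det]
  congr 1
  ext i j
  simp [A, eval_alongLine, hpt]

end Degeneration

section GeneralPosition

open scoped Matrix

variable {k : Type*} [Field k] {X : Type*}

/-- A property of a family of lines in the plane holding on a nonempty Zariski open set. -/
def HoldsGenerically (p : (X → Fin 3 → k) → Prop) : Prop :=
  ∃ Φ : MvPolynomial (X × Fin 3) k, Φ ≠ 0 ∧ ∀ v, eval (Function.uncurry v) Φ ≠ 0 → p v

namespace HoldsGenerically

theorem exists_of [Infinite k] {p : (X → Fin 3 → k) → Prop} (h : HoldsGenerically p) :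
    ∃ v, p v := by
  obtain ⟨Φ, h0, hΦ⟩ := h
  by_contra! hp
  refine h0 (MvPolynomial.funext fun x => ?_)
  rw [map_zero]
  by_contra hx
  exact hp (Function.curry x) (hΦ _ (by rwa [Function.uncurry_curry]))

theorem of_polynomial (Φ : MvPolynomial (X × Fin 3) k) {p : (X → Fin 3 → k) → Prop}
    (hp : ∀ v, eval (Function.uncurry v) Φ ≠ 0 → p v)
    (h : ∃ v : X → Fin 3 → k, eval (Function.uncurry v) Φ ≠ 0) : HoldsGenerically p := by
  refine ⟨Φ, ?_, hp⟩
  rintro rfl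
  simp at h

theorem and {p q : (X → Fin 3 → k) → Prop} (hp : HoldsGenerically p) (hq : HoldsGenerically q) :
    HoldsGenerically fun v => p v ∧ q v := by
  obtain ⟨Φ, h0, hΦ⟩ := hp
  obtain ⟨Ψ, h0', hΨ⟩ := hq
  refine ⟨Φ * Ψ, mul_ne_zero h0 h0', fun v hv => ?_⟩
  rw [map_mul] at hv
  exact ⟨hΦ v (left_ne_zero_of_mul hv), hΨ v (right_ne_zero_of_mul hv)⟩

theorem forall_finite {ι : Type*} [Finite ι] {p : ι → (X → Fin 3 → k) → Prop}
    (hp : ∀ i, HoldsGenerically (p i)) : HoldsGenerically fun v => ∀ i, p i v := by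
  have := Fintype.ofFinite ι
  choose Φ h0 hΦ using hp
  refine ⟨∏ i, Φ i, Finset.prod_ne_zero_iff.2 fun i _ => h0 i, fun v hv i => hΦ i v ?_⟩
  rw [map_prod] at hv
  exact Finset.prod_ne_zero_iff.1 hv i (mem_univ i)

theorem imp {a : Prop} {p : (X → Fin 3 → k) → Prop} (hp : a → HoldsGenerically p) :
    HoldsGenerically fun v => a → p v := by
  by_cases ha : a
  · simpa [ha] using hp ha
  · exact ⟨1, one_ne_zero, fun _ _ h => (ha h).elim⟩

end HoldsGenerically

/-- The generic line. -/
noncomputable def genericLine (k : Type*) [Field k] (x : X) :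
    Fin 3 → MvPolynomial (X × Fin 3) k :=
  fun i => MvPolynomial.X (x, i)

theorem eval_genericLine (v : X → Fin 3 → k) (x : X) (i : Fin 3) :
    eval (Function.uncurry v) (genericLine k x i) = v x i := by
  simp [genericLine]

/-- No three lines are concurrent, and no line through two nodes contains an unexpected
third node. -/
def InGeneralPosition (v : X → Fin 3 → k) : Prop :=
  (∀ x y z, [x, y, z].Nodup → v x ⬝ᵥ v y ⨯₃ v z ≠ 0) ∧
    ∀ a b a' b' x y, [a, b, a', b', x, y].Nodup →
      ((v a ⨯₃ v b) ⨯₃ (v a' ⨯₃ v b')) ⬝ᵥ (v x ⨯₃ v y) ≠ 0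

theorem holdsGenerically_inGeneralPosition [Finite X] :
    HoldsGenerically (InGeneralPosition : (X → Fin 3 → k) → Prop) := by
  classical
  refine .and ?_ ?_
  · refine .forall_finite fun x => .forall_finite fun y => .forall_finite fun z => .imp fun h => ?_
    let V := genericLine (X := X) k
    refine .of_polynomial (V x ⬝ᵥ V y ⨯₃ V z) (fun v hv => ?_)
      ⟨fun w => if w = x then ![1, 0, 0] else if w = y then ![0, 1, 0] else ![0, 0, 1], ?_⟩
    · rw [Matrix.vec3_dotProduct] at hv ⊢
      simpa [V, cross_apply, eval_genericLine] using hv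
    · simp only [List.nodup_cons, List.mem_cons, List.not_mem_nil, or_false, not_or] at h
      obtain ⟨⟨hxy, hxz⟩, hyz, -⟩ := h
      rw [Matrix.vec3_dotProduct]
      simp [V, cross_apply, eval_genericLine, Ne.symm hxy, Ne.symm hxz,
        Ne.symm hyz]
  · refine .forall_finite fun a => .forall_finite fun b => .forall_finite fun a' =>
      .forall_finite fun b' => .forall_finite fun x => .forall_finite fun y => .imp fun h => ?_
    let V := genericLine (X := X) k
    refine .of_polynomial (((V a ⨯₃ V b) ⨯₃ (V a' ⨯₃ V b')) ⬝ᵥ (V x ⨯₃ V y)) (fun v hv => ?_)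
      ⟨fun w => if w = a ∨ w = y then ![0, 1, 0] else if w = b ∨ w = a' then ![0, 0, 1]
        else ![1, 0, 0], ?_⟩
    · rw [Matrix.vec3_dotProduct] at hv ⊢
      simpa [V, cross_apply, eval_genericLine] using hv
    · simp only [List.nodup_cons, List.mem_cons, List.not_mem_nil, or_false, not_or] at h
      obtain ⟨⟨h1, h2, h3, h4, h5⟩, ⟨h6, h7, h8, h9⟩, ⟨h10, h11, h12⟩, ⟨h13, h14⟩, h15, -⟩ := h
      rw [Matrix.vec3_dotProduct]
      simp [V, cross_apply, eval_genericLine, Ne.symm h1, Ne.symm h2, Ne.symm h3,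
        Ne.symm h4, Ne.symm h7, Ne.symm h8, Ne.symm h10, Ne.symm h11, h9, h12, h14, h15]

theorem eval_aeval {σ τ : Type*} (x : τ → k) (Q : σ → MvPolynomial τ k) (f : MvPolynomial σ k) :
    eval x (aeval Q f) = eval (fun i => eval x (Q i)) f := by
  have : (aeval x).comp (aeval Q) = aeval (R := k) fun i => eval x (Q i) := by
    ext i
    simp [aeval_eq_eval]
  simpa [aeval_eq_eval] using DFunLike.congr_fun this f

/-- Independence of the conditions imposed by nodes of lines is an open condition. -/
theorem ImposesIndependent.holdsGenerically {n : ℕ} {T : Type*} [Finite T] {e : T → X × X}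
    {v₀ : X → Fin 3 → k} (h : ImposesIndependent n fun t => v₀ (e t).1 ⨯₃ v₀ (e t).2) :
    HoldsGenerically fun v : X → Fin 3 → k =>
      ImposesIndependent n fun t => v (e t).1 ⨯₃ v (e t).2 := by
  classical
  have := Fintype.ofFinite T
  obtain ⟨g, hg, hg1, hg0⟩ := h
  let V := genericLine (X := X) k
  let A : Matrix T T (MvPolynomial (X × Fin 3) k) :=
    Matrix.of fun i j => aeval (V (e i).1 ⨯₃ V (e i).2) (g j)
  have hA : ∀ v : X → Fin 3 → k, eval (Function.uncurry v) A.det =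
      (Matrix.of fun i j => eval (v (e i).1 ⨯₃ v (e i).2) (g j)).det := by
    intro v
    rw [RingHom.map_det]
    congr 1
    ext i j
    simp only [A, RingHom.mapMatrix_apply, Matrix.map_apply, Matrix.of_apply, eval_aeval]
    congr 2
    ext l
    fin_cases l <;> simp [V, cross_apply, eval_genericLine]
  refine .of_polynomial A.det (fun v hv => .of_det g hg (by rwa [← hA])) ⟨v₀, ?_⟩
  have : (Matrix.of fun i j => eval (v₀ (e i).1 ⨯₃ v₀ (e i).2) (g j)) = 1 := by
    ext i j
    by_cases hij : i = j
    · subst hij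
      simp [hg1]
    · simp [hij, hg0 j i (Ne.symm hij)]
  rw [hA, this, Matrix.det_one]
  exact one_ne_zero

/-- The line joining two nodes of lines in general position. -/
theorem InGeneralPosition.exists_line {v : X → Fin 3 → k} (hv : InGeneralPosition v)
    {u u' : Fin 2 → X} (hu : [u 0, u' 0, u 1, u' 1].Nodup) :
    ∃ l : Fin 3 → k,
      (∀ x y, x ≠ y → (∀ j, s(x, y) ≠ s(u j, u' j)) → l ⬝ᵥ v x ⨯₃ v y ≠ 0) ∧
      ∀ j, ∃ α β : k, α ≠ 0 ∧ β ≠ 0 ∧ v (u j) ⨯₃ l = α • v (u j) ⨯₃ v (u' j) ∧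
        v (u' j) ⨯₃ l = β • v (u j) ⨯₃ v (u' j) := by
  obtain ⟨h3, h6⟩ := hv
  have hcross : ∀ a b p : Fin 3 → k, a ⨯₃ ((a ⨯₃ b) ⨯₃ p) = (a ⬝ᵥ p) • a ⨯₃ b ∧
      b ⨯₃ ((a ⨯₃ b) ⨯₃ p) = (b ⬝ᵥ p) • a ⨯₃ b := by
    intro a b p
    constructor <;> ext i <;> fin_cases i <;>
      simp [cross_apply, Matrix.vec3_dotProduct] <;> ring
  have hcross' : ∀ a b p : Fin 3 → k, a ⨯₃ (p ⨯₃ (a ⨯₃ b)) = (-(a ⬝ᵥ p)) • a ⨯₃ b ∧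
      b ⨯₃ (p ⨯₃ (a ⨯₃ b)) = (-(b ⬝ᵥ p)) • a ⨯₃ b := by
    intro a b p
    constructor <;> ext i <;> fin_cases i <;>
      simp [cross_apply, Matrix.vec3_dotProduct] <;> ring
  have hdot : ∀ a b p y : Fin 3 → k, ((a ⨯₃ b) ⨯₃ p) ⬝ᵥ a ⨯₃ y = -((a ⬝ᵥ p) * (y ⬝ᵥ a ⨯₃ b)) := by
    intro a b p y
    simp only [Matrix.vec3_dotProduct]
    simp [cross_apply]
    ring
  have hdot' : ∀ a b p y : Fin 3 → k, ((a ⨯₃ b) ⨯₃ p) ⬝ᵥ b ⨯₃ y = -((b ⬝ᵥ p) * (y ⬝ᵥ a ⨯₃ b)) := by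
    intro a b p y
    simp only [Matrix.vec3_dotProduct]
    simp [cross_apply]
    ring
  simp only [List.nodup_cons, List.mem_cons, List.not_mem_nil, or_false, not_or] at hu
  obtain ⟨⟨h1, h2, h4⟩, ⟨h5, h7⟩, h8, -⟩ := hu
  have hns : ∀ {x y z : X}, x ≠ y → x ≠ z → y ≠ z → v x ⬝ᵥ v y ⨯₃ v z ≠ 0 := fun hxy hxz hyz =>
    h3 _ _ _ (by simp [hxy, hxz, hyz])
  refine ⟨(v (u 0) ⨯₃ v (u' 0)) ⨯₃ (v (u 1) ⨯₃ v (u' 1)), fun x y hxy hj => ?_, fun j => ?_⟩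
  · have key : ∀ x y, x ≠ y → (∀ j, s(x, y) ≠ s(u j, u' j)) →
        (x = u 0 ∨ x = u' 0 ∨ x = u 1 ∨ x = u' 1) →
        ((v (u 0) ⨯₃ v (u' 0)) ⨯₃ (v (u 1) ⨯₃ v (u' 1))) ⬝ᵥ (v x ⨯₃ v y) ≠ 0 := by
      intro x y hxy hj hx
      have hj0 := hj 0
      have hj1 := hj 1
      simp only [ne_eq, Sym2.eq_iff, not_or, not_and] at hj0 hj1
      rcases hx with rfl | rfl | rfl | rfl
      · rw [hdot, neg_ne_zero]
        exact mul_ne_zero (hns h2 h4 h8) (hns (Ne.symm hxy) (Ne.symm (hj0.1 rfl ∘ Eq.symm)) h1)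
      · rw [hdot', neg_ne_zero]
        exact mul_ne_zero (hns h5 h7 h8)
          (hns (fun h => hj0.2 rfl h |>.elim) (Ne.symm hxy) h1)
      · rw [← cross_anticomm, neg_dotProduct, hdot, neg_neg]
        exact mul_ne_zero (hns (Ne.symm h2) (Ne.symm h5) h1)
          (hns (Ne.symm hxy) (fun h => hj1.1 rfl h) h8)
      · rw [← cross_anticomm, neg_dotProduct, hdot', neg_neg]
        exact mul_ne_zero (hns (Ne.symm h4) (Ne.symm h7) h1)
          (hns (fun h => hj1.2 rfl h) (Ne.symm hxy) h8)
    by_cases hx : x = u 0 ∨ x = u' 0 ∨ x = u 1 ∨ x = u' 1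
    · exact key x y hxy hj hx
    by_cases hy : y = u 0 ∨ y = u' 0 ∨ y = u 1 ∨ y = u' 1
    · rw [← cross_anticomm (v y), dotProduct_neg, neg_ne_zero]
      exact key y x hxy.symm (fun j => by rw [Sym2.eq_swap]; exact hj j) hy
    · simp only [not_or] at hx hy
      apply h6
      simp [h1, h2, h4, h5, h7, h8, hxy, Ne.symm hx.1, Ne.symm hx.2.1, Ne.symm hx.2.2.1,
        Ne.symm hx.2.2.2, Ne.symm hy.1, Ne.symm hy.2.1, Ne.symm hy.2.2.1, Ne.symm hy.2.2.2]
  · fin_cases j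
    · exact ⟨_, _, hns h2 h4 h8, hns h5 h7 h8, (hcross _ _ _).1, (hcross _ _ _).2⟩
    · exact ⟨_, _, neg_ne_zero.2 (hns (Ne.symm h2) (Ne.symm h5) h1),
        neg_ne_zero.2 (hns (Ne.symm h4) (Ne.symm h7) h1), (hcross' _ _ _).1, (hcross' _ _ _).2⟩

end GeneralPosition

section Grid

open scoped Matrix

variable {k : Type*} [Field k] {X : Type*}

theorem exists_eq_smul_cross {a b x : Fin 3 → k} (hab : a ⨯₃ b ≠ 0) (ha : a ⬝ᵥ x = 0)
    (hb : b ⬝ᵥ x = 0) : ∃ c : k, x = c • a ⨯₃ b := by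
  obtain ⟨u, hu⟩ := exists_dotProduct_ne_zero hab
  have h := cross_cross_eq_smul_sub_smul' u (a ⨯₃ b) x
  rw [cross_cross_eq_smul_sub_smul, ha, hb, zero_smul, zero_smul, sub_zero, map_zero, eq_comm,
    sub_eq_zero] at h
  refine ⟨(u ⬝ᵥ a ⨯₃ b)⁻¹ * (u ⬝ᵥ x), ?_⟩
  rw [mul_smul, h, dotProduct_comm (a ⨯₃ b), smul_smul, inv_mul_cancel₀ hu, one_smul]

/-- A form of degree `n` vanishing on more than `n` distinct hyperplanes of a subspace `U`
vanishes on `U`. -/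
theorem MvPolynomial.IsHomogeneous.eval_eq_zero_of_card_lt [Infinite k] {n : ℕ}
    {f : MvPolynomial (Fin 3) k} (hf : f.IsHomogeneous n) {U : Submodule k (Fin 3 → k)}
    {v : X → Fin 3 → k} {S : Finset X} (hS : n < #S)
    (h0 : ∀ t ∈ S, ∀ x ∈ U, v t ⬝ᵥ x = 0 → eval x f = 0)
    (hU : ∀ i ∈ S, ∀ j ∈ S, i ≠ j → ∃ x ∈ U, v j ⬝ᵥ x = 0 ∧ v i ⬝ᵥ x ≠ 0) :
    ∀ x ∈ U, eval x f = 0 := by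
  intro x hx
  by_contra hfx
  have hvx : ∀ i : S, v i ⬝ᵥ x ≠ 0 := fun i hi => hfx (h0 i i.2 x hx hi)
  obtain ⟨y, hy, hy0⟩ := Module.Dual.exists_forall_mem_ne_zero_of_forall_exists U
    (Sum.elim (fun i : S => dotProductEquiv k (Fin 3) (v i))
      fun p : {p : S × S // p.1 ≠ p.2} => (v p.1.1 ⬝ᵥ x) • dotProductEquiv k (Fin 3) (v p.1.2) -
        (v p.1.2 ⬝ᵥ x) • dotProductEquiv k (Fin 3) (v p.1.1)) <| by
    rintro (i | ⟨⟨i, j⟩, hij⟩)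
    · exact ⟨x, hx, hvx i⟩
    · obtain ⟨z, hz, hj, hi⟩ := hU i i.2 j j.2 fun h => hij (Subtype.ext h)
      exact ⟨z, hz, by simpa [hj, hi] using hvx j⟩
  have hp : alongLine x y f = 0 := by
    refine Polynomial.eq_zero_of_natDegree_lt_card_of_eval_eq_zero _
      (f := fun i : S => -((v i ⬝ᵥ x) / (v i ⬝ᵥ y))) (fun i j hij => ?_) (fun i => ?_) ?_
    · by_contra hne
      have hi : v i ⬝ᵥ y ≠ 0 := hy0 (.inl i)
      have hj : v j ⬝ᵥ y ≠ 0 := hy0 (.inl j)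
      refine hy0 (.inr ⟨(i, j), hne⟩) ?_
      have := neg_injective hij
      rw [div_eq_div_iff hi hj] at this
      simpa [sub_eq_zero] using this
    · have hi : v i ⬝ᵥ y ≠ 0 := hy0 (.inl i)
      rw [eval_alongLine]
      refine h0 i i.2 _ (U.add_mem hx (U.smul_mem _ hy)) ?_
      rw [dotProduct_add, dotProduct_smul, smul_eq_mul, neg_mul, div_mul_cancel₀ _ hi,
        add_neg_cancel]
    · have := aeval_natDegree_le (m := n) (n := 1) f hf.totalDegree_le
        (fun i => Polynomial.C (x i) + Polynomial.C (y i) * Polynomial.X) fun i => by compute_degree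
      rw [Fintype.card_coe]
      exact lt_of_le_of_lt (by simpa [alongLine] using this) hS
  refine hfx ?_
  have := eval_alongLine x y f 0
  rw [hp] at this
  simpa using this.symm

/-- A form vanishing at too many nodes of an arrangement of lines is zero. -/
theorem MvPolynomial.IsHomogeneous.eq_zero_of_nodes [Infinite k] {n : ℕ}
    {f : MvPolynomial (Fin 3) k} (hf : f.IsHomogeneous n) {v : X → Fin 3 → k}
    (h2 : ∀ x y, x ≠ y → v x ⨯₃ v y ≠ 0)
    (h3 : ∀ x y z, [x, y, z].Nodup → v x ⬝ᵥ v y ⨯₃ v z ≠ 0)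
    {A : Finset X} {S : X → Finset X} (hA : n < #A) (hS : ∀ a ∈ A, n < #(S a))
    (hSa : ∀ a ∈ A, a ∉ S a) (h0 : ∀ a ∈ A, ∀ t ∈ S a, eval (v a ⨯₃ v t) f = 0) : f = 0 := by
  have hline : ∀ a ∈ A, ∀ x, v a ⬝ᵥ x = 0 → eval x f = 0 := by
    intro a ha
    refine hf.eval_eq_zero_of_card_lt (U := LinearMap.ker (dotProductEquiv k (Fin 3) (v a)))
      (v := v) (hS a ha) (fun t ht x hx hxt => ?_) fun i hi j hj hij => ?_
    · have hat : a ≠ t := fun h => hSa a ha (h ▸ ht)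
      obtain ⟨c, rfl⟩ := exists_eq_smul_cross (h2 a t hat) hx hxt
      rw [hf.eval_smul, h0 a ha t ht, mul_zero]
    · refine ⟨v a ⨯₃ v j, dot_self_cross _ _, dot_cross_self _ _, h3 _ _ _ ?_⟩
      have hai : a ≠ i := fun h => hSa a ha (h ▸ hi)
      have haj : a ≠ j := fun h => hSa a ha (h ▸ hj)
      simp [hai.symm, haj, hij]
  refine MvPolynomial.funext fun x => ?_
  rw [map_zero]
  refine hf.eval_eq_zero_of_card_lt (U := ⊤) (v := v) hA (fun t ht x _ => hline t ht x)
    (fun i hi j hj hij => ?_) x trivial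
  obtain ⟨u, hu⟩ := exists_dotProduct_ne_zero (h2 i j hij)
  exact ⟨v j ⨯₃ u, trivial, dot_self_cross _ _, by rwa [← triple_product_permutation]⟩

theorem InGeneralPosition.cross_ne_zero {v : X → Fin 3 → k} (hv : InGeneralPosition v)
    {x y : X} (z : X) (h : [x, y, z].Nodup) : v x ⨯₃ v y ≠ 0 := by
  intro h0
  have := hv.1 x y z h
  rw [triple_product_permutation, triple_product_permutation, h0, dotProduct_zero] at this
  exact this rfl

variable {ι κ : Type*} [DecidableEq ι] [DecidableEq κ]

theorem exists_eval_node_ne_zero [Infinite k] {A : Finset ι} {c : ι → κ} {i₀ : κ}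
    {v : Bool × ι → Fin 3 → k} (h2 : ∀ x y, x ≠ y → v x ⨯₃ v y ≠ 0)
    (h3 : ∀ x y z, [x, y, z].Nodup → v x ⬝ᵥ v y ⨯₃ v z ≠ 0)
    (hd : ∀ i, #{x ∈ A | c x = i} + 2 ≤ #{x ∈ A | c x ≠ i₀})
    (hn : #A + 2 < 2 * #{x ∈ A | c x ≠ i₀}) {f : MvPolynomial (Fin 3) k} (hf0 : f ≠ 0)
    (hf : f.IsHomogeneous #A)
    (hv : ∀ σ, ∀ x ∈ A, ∀ y ∈ A, c x ≠ c y → eval (v (σ, x) ⨯₃ v (σ, y)) f = 0) (a₀ b₀ : ι) :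
    ∃ a b, (a ≠ a₀ ∧ a ∈ A ∧ c a ≠ i₀) ∧ (b ≠ b₀ ∧ b ∈ A ∧ c b ≠ i₀) ∧
      eval (v (false, a) ⨯₃ v (true, b)) f ≠ 0 := by
  by_contra! hcon
  let e : Bool → ι := fun σ => if σ then b₀ else a₀
  have hcon' : ∀ σ x y, (x ≠ e σ ∧ x ∈ A ∧ c x ≠ i₀) → (y ≠ e (!σ) ∧ y ∈ A ∧ c y ≠ i₀) →
      eval (v (σ, x) ⨯₃ v (!σ, y)) f = 0 := by
    rintro (_ | _) x y hx hy
    · exact hcon x y hx hy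
    · rw [← cross_anticomm, ← neg_one_smul k, hf.eval_smul]
      exact mul_eq_zero_of_right _ (hcon y x hy hx)
  have hinj : ∀ σ : Bool, Function.Injective (Prod.mk σ : ι → Bool × ι) :=
    fun σ => Prod.mk_right_injective σ
  let B : Bool → Finset ι := fun σ => {x ∈ A | c x ≠ i₀}.erase (e σ)
  have hB : ∀ σ, #{x ∈ A | c x ≠ i₀} ≤ #(B σ) + 1 := fun σ =>
    Nat.sub_le_iff_le_add.1 Finset.pred_card_le_card_erase
  have hmem : ∀ σ x, x ∈ B σ ↔ x ≠ e σ ∧ x ∈ A ∧ c x ≠ i₀ := by simp [B]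
  have hBA : ∀ p ∈ (B false).image (Prod.mk false) ∪ (B true).image (Prod.mk true),
      p.2 ∈ B p.1 := by
    simp only [mem_union, mem_image]
    rintro _ (⟨x, h, rfl⟩ | ⟨x, h, rfl⟩) <;> exact h
  refine hf0 (hf.eq_zero_of_nodes h2 h3
    (A := (B false).image (Prod.mk false) ∪ (B true).image (Prod.mk true))
    (S := fun p => (B (!p.1)).image (Prod.mk (!p.1)) ∪
      {y ∈ A | c y ≠ c p.2}.image (Prod.mk p.1)) ?_ ?_ ?_ ?_)
  · rw [card_union_of_disjoint, card_image_of_injective _ (hinj _),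
      card_image_of_injective _ (hinj _)]
    · have := hB false
      have := hB true
      omega
    · simp [Finset.disjoint_left]
  · rintro ⟨σ, x⟩ -
    rw [card_union_of_disjoint, card_image_of_injective _ (hinj _),
      card_image_of_injective _ (hinj _)]
    · have h := Finset.card_filter_add_card_filter_not (s := A) fun y => c y = c x
      have := hB (!σ)
      have := hd (c x)
      simp only [ne_eq] at *
      omega
    · simp [Finset.disjoint_left]
  · rintro ⟨σ, x⟩ -
    simp
  · rintro ⟨σ, x⟩ hx ⟨τ, y⟩ hy
    have hx' := (hmem σ x).1 (hBA _ hx)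
    simp only [mem_union, mem_image, Prod.mk.injEq, exists_eq_right_right] at hy
    rcases hy with ⟨h, rfl⟩ | ⟨h, rfl⟩
    · exact hcon' σ x y hx' ((hmem _ _).1 h)
    · rw [mem_filter] at h
      exact hv σ x hx'.2.1 y h.1 (Ne.symm h.2)

end Grid

section CrossNodes

open scoped Matrix

variable {k : Type*} [Field k] {ι κ : Type*} [DecidableEq κ]

/-- The ordered pairs of elements of `A` of different colours. -/
def bicolored (c : ι → κ) (A : Finset ι) : Finset (ι × ι) :=
  {p ∈ A ×ˢ A | c p.1 ≠ c p.2}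

theorem mem_bicolored {c : ι → κ} {A : Finset ι} {p : ι × ι} :
    p ∈ bicolored c A ↔ (p.1 ∈ A ∧ p.2 ∈ A) ∧ c p.1 ≠ c p.2 := by
  simp [bicolored]

/-- If the nodes indexed by `T` impose independent conditions and there are as many of them as
bicolored pairs, then every node of both arrangements is indexed by `T`. -/
theorem eval_node_eq_zero_of_card_eq [DecidableEq ι] {c : ι → κ} {A : Finset ι}
    {v : Bool × ι → Fin 3 → k} {T : Type*} [Fintype T] {e : T → Bool × ι × ι}
    (he : ∀ t, (e t).2 ∈ bicolored c A) {n : ℕ}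
    (hT : ImposesIndependent n fun t => v ((e t).1, (e t).2.1) ⨯₃ v ((e t).1, (e t).2.2))
    (hcard : Fintype.card T = #(bicolored c A)) {f : MvPolynomial (Fin 3) k}
    (hf : f.IsHomogeneous n)
    (h0 : ∀ t, eval (v ((e t).1, (e t).2.1) ⨯₃ v ((e t).1, (e t).2.2)) f = 0)
    (σ : Bool) {x y : ι} (hx : x ∈ A) (hy : y ∈ A) (hxy : c x ≠ c y) :
    eval (v (σ, x) ⨯₃ v (σ, y)) f = 0 := by
  let φ : T ⊕ T → Bool × ι × ι := Sum.elim e fun t => ((e t).1, (e t).2.2, (e t).2.1)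
  have hne : ∀ t, (e t).2.1 ≠ (e t).2.2 := fun t h => (mem_bicolored.1 (he t)).2 (congrArg c h)
  have h1 : ∀ t t', e t = e t' → t = t' := by
    intro t t' h
    by_contra htt
    exact hT.ne_smul htt 1 (by simp only [h, one_smul])
  have h2 : ∀ t t', e t ≠ ((e t').1, (e t').2.2, (e t').2.1) := by
    intro t t' h
    by_cases htt : t = t'
    · subst htt
      exact hne t (congrArg (·.2.1) h)
    · refine hT.ne_smul htt (-1) ?_
      simp only [h, neg_one_smul, cross_anticomm]
  have hφ : φ.Injective := by
    rintro (t | t) (t' | t') h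
    · exact congrArg _ (h1 t t' h)
    · exact (h2 t t' h).elim
    · exact (h2 t' t h.symm).elim
    · refine congrArg _ (h1 t t' ?_)
      simp only [φ, Sum.elim_inr, Prod.mk.injEq] at h
      exact Prod.ext h.1 (Prod.ext h.2.2 h.2.1)
  have himage : univ.image φ = univ ×ˢ bicolored c A := by
    refine Finset.eq_of_subset_of_card_le (fun p hp => ?_) ?_
    · obtain ⟨t | t, -, rfl⟩ := Finset.mem_image.1 hp
      · simpa [φ] using he t
      · have := mem_bicolored.1 (he t)
        simpa [φ, mem_bicolored] using ⟨⟨this.1.2, this.1.1⟩, Ne.symm this.2⟩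
    · rw [card_image_of_injective _ hφ, card_univ, Fintype.card_sum, card_product, hcard,
        card_univ, Fintype.card_bool, two_mul]
  have hmem : (σ, x, y) ∈ univ.image φ := by
    rw [himage]
    simp [mem_bicolored, hx, hy, hxy]
  obtain ⟨t | t, -, ht⟩ := Finset.mem_image.1 hmem
  · simp only [φ, Sum.elim_inl] at ht
    simpa [ht] using h0 t
  · simp only [φ, Sum.elim_inr, Prod.mk.injEq] at ht
    have := h0 t
    rw [ht.1, ht.2.1, ht.2.2, ← cross_anticomm, ← neg_one_smul k, hf.eval_smul] at this
    exact (mul_eq_zero.1 this).resolve_left (pow_ne_zero _ (neg_ne_zero.2 one_ne_zero))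

theorem exists_crossNodes [Infinite k] [DecidableEq ι] {c : ι → κ} {A : Finset ι} {i₀ : κ}
    {v : Bool × ι → Fin 3 → k} (h2 : ∀ x y, x ≠ y → v x ⨯₃ v y ≠ 0)
    (h3 : ∀ x y z, [x, y, z].Nodup → v x ⬝ᵥ v y ⨯₃ v z ≠ 0)
    {T : Type*} [Fintype T] {e : T → Bool × ι × ι} (he : ∀ t, (e t).2 ∈ bicolored c A)
    (hT : ImposesIndependent #A fun t => v ((e t).1, (e t).2.1) ⨯₃ v ((e t).1, (e t).2.2))
    {m : ℕ} (hm : m ≤ 2) (hmT : 0 < m → Fintype.card T = #(bicolored c A) ∧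
      Fintype.card T + m ≤ (#A + 2).choose 2 ∧
      (∀ i, #{x ∈ A | c x = i} + 2 ≤ #{x ∈ A | c x ≠ i₀}) ∧
      #A + 2 < 2 * #{x ∈ A | c x ≠ i₀}) :
    ∃ a b : Fin m → ι, a.Injective ∧ b.Injective ∧ (∀ j, a j ∈ A ∧ c (a j) ≠ i₀) ∧
      (∀ j, b j ∈ A ∧ c (b j) ≠ i₀) ∧
      ImposesIndependent #A (Sum.elim
        (fun t => v ((e t).1, (e t).2.1) ⨯₃ v ((e t).1, (e t).2.2))
        fun j => v (false, a j) ⨯₃ v (true, b j)) := by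
  induction m with
  | zero =>
    refine ⟨Fin.elim0, Fin.elim0, fun i => i.elim0, fun i => i.elim0, fun i => i.elim0,
      fun i => i.elim0, ?_⟩
    convert hT.comp (Equiv.sumEmpty T (Fin 0)).injective using 1
    ext (t | t) : 1
    · rfl
    · exact t.elim0
  | succ m ih =>
    obtain ⟨hT1, hT2, hd, hn⟩ := hmT m.succ_pos
    obtain ⟨a, b, ha, hb, ha', hb', hab⟩ := ih (by omega) fun _ => ⟨hT1, by omega, hd, hn⟩
    obtain ⟨f, hf0, hf, hfz⟩ := exists_form_vanishing (n := #A) (Sum.elim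
        (fun t => v ((e t).1, (e t).2.1) ⨯₃ v ((e t).1, (e t).2.2))
        fun j => v (false, a j) ⨯₃ v (true, b j)) (by simpa using by omega)
    obtain ⟨x₀⟩ : Nonempty ι := by
      by_contra h
      rw [not_nonempty_iff] at h
      simp [Finset.eq_empty_of_isEmpty] at hn
    have hm0 : ∀ i j : Fin m, i = j := fun i j => Fin.ext (by omega)
    obtain ⟨x, y, hx, hy, hxy⟩ := exists_eval_node_ne_zero h2 h3 hd hn hf0 hf
      (fun σ x hx y hy => eval_node_eq_zero_of_card_eq he hT hT1 hf (fun t => hfz (.inl t)) σ hx hy)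
      (if h : 0 < m then a ⟨0, h⟩ else x₀) (if h : 0 < m then b ⟨0, h⟩ else x₀)
    have hxa : ∀ j, x ≠ a j := by
      intro j
      have := hx.1
      rw [dif_pos j.pos] at this
      rwa [hm0 j ⟨0, j.pos⟩]
    have hyb : ∀ j, y ≠ b j := by
      intro j
      have := hy.1
      rw [dif_pos j.pos] at this
      rwa [hm0 j ⟨0, j.pos⟩]
    refine ⟨Fin.cons x a, Fin.cons y b, Fin.cons_injective_iff.2 ⟨?_, ha⟩,
      Fin.cons_injective_iff.2 ⟨?_, hb⟩, Fin.cons hx.2 ha', Fin.cons hy.2 hb', ?_⟩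
    · rintro ⟨j, hj⟩
      exact hxa j hj.symm
    · rintro ⟨j, hj⟩
      exact hyb j hj.symm
    · have key := (hab.sumElim_unit hf hfz hxy).comp
        (e := Sum.elim (Sum.inl ∘ Sum.inl) (Fin.cons (.inr ()) (Sum.inl ∘ Sum.inr))) <| by
        rintro (t | i) (t' | j) h
        · simpa using h
        · induction j using Fin.cases <;> simp at h
        · induction i using Fin.cases <;> simp at h
        · induction i using Fin.cases <;> induction j using Fin.cases <;> simp at h ⊢
          exact h
      convert key using 1
      ext (t | i) : 1
      · rfl
      · induction i using Fin.cases <;> rfl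

end CrossNodes

section Horace

open scoped Matrix

variable {k : Type*} [Field k] {ι κ : Type} [DecidableEq κ]

variable (k) in
/-- For some choice of two families of lines indexed by `A` and coloured by `c`, there are `N`
bicoloured nodes imposing independent conditions on forms of degree `#A`. -/
def HasIndependentNodes (c : ι → κ) (A : Finset ι) (N : ℕ) : Prop :=
  ∃ (v : Bool × ι → Fin 3 → k) (T : Type) (_ : Fintype T) (e : T → Bool × ι × ι),
    (∀ t, (e t).2 ∈ bicolored c A) ∧ Fintype.card T = N ∧
      ImposesIndependent #A fun t => v ((e t).1, (e t).2.1) ⨯₃ v ((e t).1, (e t).2.2)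

/-- Independent nodes remain independent for lines in general position, together with four
auxiliary lines. -/
theorem HasIndependentNodes.exists_inGeneralPosition [Infinite k] [Finite ι] {c : ι → κ}
    {A : Finset ι} {N : ℕ} (h : HasIndependentNodes k c A N) :
    ∃ (v : (Bool × ι) ⊕ Fin 4 → Fin 3 → k) (T : Type) (_ : Fintype T) (e : T → Bool × ι × ι),
      InGeneralPosition v ∧ (∀ t, (e t).2 ∈ bicolored c A) ∧ Fintype.card T = N ∧
        ImposesIndependent #A fun t =>
          v (.inl ((e t).1, (e t).2.1)) ⨯₃ v (.inl ((e t).1, (e t).2.2)) := by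
  obtain ⟨v, T, _, e, he, hN, hT⟩ := h
  let E : T → ((Bool × ι) ⊕ Fin 4) × ((Bool × ι) ⊕ Fin 4) := fun t =>
    (.inl ((e t).1, (e t).2.1), .inl ((e t).1, (e t).2.2))
  have h0 : ImposesIndependent #A fun t =>
      Sum.elim v (fun _ : Fin 4 => 0) (E t).1 ⨯₃ Sum.elim v (fun _ : Fin 4 => 0) (E t).2 := hT
  obtain ⟨v', hgp, hv'⟩ :=
    (holdsGenerically_inGeneralPosition.and h0.holdsGenerically).exists_of
  exact ⟨v', T, inferInstance, e, hgp, he, hN, hv'⟩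

theorem HasIndependentNodes.add_line [Infinite k] [Finite ι] [DecidableEq ι] {c : ι → κ}
    {A : Finset ι} {x₀ : ι} (hx₀ : x₀ ∉ A) {N : ℕ} (h : HasIndependentNodes k c A N) {m : ℕ}
    (hm : m ≤ 2) (hms : m ≤ #{x ∈ A | c x ≠ c x₀})
    (hmN : 0 < m → N = #(bicolored c A) ∧ N + m ≤ (#A + 2).choose 2 ∧
      (∀ i, #{x ∈ A | c x = i} + 2 ≤ #{x ∈ A | c x ≠ c x₀}) ∧
      #A + 2 < 2 * #{x ∈ A | c x ≠ c x₀}) :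
    HasIndependentNodes k c (insert x₀ A)
      (N + m + min (2 * #{x ∈ A | c x ≠ c x₀} - m) (#A + 2)) := by
  obtain ⟨v, T, _, e, hgp, he, hN, hT⟩ := h.exists_inGeneralPosition
  have h3 : ∀ x y z : Bool × ι, [x, y, z].Nodup → v (.inl x) ⬝ᵥ v (.inl y) ⨯₃ v (.inl z) ≠ 0 :=
    fun x y z h => hgp.1 _ _ _ (by simpa using h)
  have h2 : ∀ x y : Bool × ι, x ≠ y → v (.inl x) ⨯₃ v (.inl y) ≠ 0 :=
    fun x y h => hgp.cross_ne_zero (.inr 0) (by simpa using h)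
  obtain ⟨a, b, ha, hb, ha', hb', hab⟩ := exists_crossNodes (v := fun x => v (.inl x)) h2 h3 he hT
    hm fun h => hN ▸ hmN h
  let u : Fin 2 → (Bool × ι) ⊕ Fin 4 := fun j =>
    if h : (j : ℕ) < m then .inl (false, a ⟨j, h⟩) else .inr (Fin.castLE (by simp) j)
  let u' : Fin 2 → (Bool × ι) ⊕ Fin 4 := fun j =>
    if h : (j : ℕ) < m then .inl (true, b ⟨j, h⟩) else .inr (Fin.natAdd 2 j)
  have hu : [u 0, u' 0, u 1, u' 1].Nodup := by
    interval_cases m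
    · simp [u, u']
    · simp [u, u']
    · have h01 : (0 : Fin 2) ≠ 1 := by simp
      simpa [u, u'] using ⟨ha.ne h01, hb.ne h01⟩
  obtain ⟨l, hl, hlu⟩ := hgp.exists_line hu
  have hlab : ∀ j : Fin m, ∃ α β : k, α ≠ 0 ∧ β ≠ 0 ∧
      v (.inl (false, a j)) ⨯₃ l = α • v (.inl (false, a j)) ⨯₃ v (.inl (true, b j)) ∧
      v (.inl (true, b j)) ⨯₃ l = β • v (.inl (false, a j)) ⨯₃ v (.inl (true, b j)) := by
    intro j
    have := hlu (Fin.castLE hm j)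
    simpa [u, u'] using this
  choose α β hα hβ hαl hβl using hlab
  have hlv : ∀ x y : Bool × ι, x ≠ y →
      (∀ j, s(x, y) ≠ s((false, a j), (true, b j))) → l ⬝ᵥ v (.inl x) ⨯₃ v (.inl y) ≠ 0 := by
    intro x y hxy hj
    refine hl _ _ (by simpa using hxy) fun j => ?_
    by_cases h : (j : ℕ) < m
    · simpa [u, u', h] using hj ⟨j, h⟩
    · simp [u, u', h]
  have hvl : ∀ x : Bool × ι, v (.inl x) ⨯₃ l ≠ 0 := by
    intro x hx
    refine hl (.inl x) (.inr 0) (by simp) (fun j => ?_) ?_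
    · by_cases h : (j : ℕ) < m <;> simp [u, u', h]
    · rw [triple_product_permutation, triple_product_permutation, ← cross_anticomm, hx, neg_zero,
        dotProduct_zero]
  obtain ⟨d, hd⟩ := Module.Dual.exists_forall_ne_zero_of_forall_exists
    (fun x : Bool × ι => dotProductEquiv k (Fin 3) (l ⨯₃ v (.inl x))) fun x => by
      obtain ⟨y, hy⟩ := exists_dotProduct_ne_zero (hvl x)
      refine ⟨y, ?_⟩
      rw [dotProductEquiv_apply_apply, ← cross_anticomm, neg_dotProduct, neg_ne_zero]
      rwa [dotProduct_comm]
  have hld : ∀ x : Bool × ι, l ⬝ᵥ v (.inl x) ⨯₃ d ≠ 0 := by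
    intro x
    have := hd x
    rwa [dotProductEquiv_apply_apply, dotProduct_comm, triple_product_permutation] at this
  let S : Finset (Bool × ι) := univ ×ˢ {x ∈ A | c x ≠ c x₀}
  have hS : ∀ x ∈ S, x.2 ∈ A ∧ c x.2 ≠ c x₀ := fun x hx => by simpa [S] using hx
  have hainj : (fun j : Fin m => (false, a j)).Injective := fun i j h => ha (congrArg (·.2) h)
  have hbinj : (fun j : Fin m => (true, b j)).Injective := fun i j h => hb (congrArg (·.2) h)
  obtain ⟨W, haW, hWb, hW⟩ := Finset.exists_subsuperset_card_eq
    (s := univ.image fun j : Fin m => (false, a j))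
    (t := S \ univ.image fun j : Fin m => (true, b j))
    (n := min (2 * #{x ∈ A | c x ≠ c x₀} - m) (#A + 2))
    (by
      intro x hx
      obtain ⟨j, -, rfl⟩ := mem_image.1 hx
      simpa [S] using ha' j)
    (by
      rw [card_image_of_injective _ hainj, card_univ, Fintype.card_fin]
      omega)
    (by
      rw [card_sdiff_of_subset, card_image_of_injective _ hbinj, card_product]
      · simp
      · intro x hx
        obtain ⟨j, -, rfl⟩ := mem_image.1 hx
        simpa [S] using hb' j)
  have hWS : ∀ x : W, x.1 ∈ S := fun x => (mem_sdiff.1 (hWb x.2)).1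
  have hWb' : ∀ (x : W) j, x.1 ≠ (true, b j) := fun x j h =>
    (mem_sdiff.1 (hWb x.2)).2 (mem_image.2 ⟨j, mem_univ _, h.symm⟩)
  let w : W → Fin 3 → k := fun x => v (.inl x) ⨯₃ l
  let q : W → Fin 3 → k := fun x => if x.1.1 then v (.inl x) ⨯₃ d else 0
  let π : Fin m → W := fun j => ⟨(false, a j), haW (mem_image_of_mem _ (mem_univ j))⟩
  let z : T → Fin 3 → k := fun t =>
    v (.inl ((e t).1, (e t).2.1)) ⨯₃ v (.inl ((e t).1, (e t).2.2))
  have hz : ∀ t, l ⬝ᵥ z t ≠ 0 := by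
    intro t
    refine hlv _ _ (fun h => (mem_bicolored.1 (he t)).2 ?_) fun j => ?_
    · exact congrArg (fun x => c x.2) h
    · rw [ne_eq, Sym2.eq_iff]
      simp only [Prod.mk.injEq]
      rintro (⟨⟨h, -⟩, h', -⟩ | ⟨⟨h, -⟩, h', -⟩) <;> rw [h] at h' <;> cases h'
  have hres : ImposesIndependent #A (Sum.elim z (w ∘ π)) := by
    convert hab.smul (u := Sum.elim (fun _ => 1) α) (by rintro (t | j); exacts [one_ne_zero, hα j])
      using 1
    ext (t | j) : 1
    · simp [z]
    · simp [w, π, hαl]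
  have hww : ∀ x y : W, x ≠ y → w x ⨯₃ w y ≠ 0 := by
    intro x y hxy
    have h := cross_cross_eq_smul_sub_smul (v (.inl x.1)) l (w y)
    rw [dot_cross_self, zero_smul, sub_zero] at h
    rw [h]
    refine smul_ne_zero ?_ fun h => hvl x.1 (by rw [h, map_zero])
    change v (.inl x.1) ⬝ᵥ v (.inl y.1) ⨯₃ l ≠ 0
    rw [triple_product_permutation, triple_product_permutation]
    refine hlv _ _ (fun h => hxy (Subtype.ext h)) fun j => ?_
    rw [ne_eq, Sym2.eq_iff]
    rintro (h | h)
    exacts [hWb' y j h.2, hWb' x j h.1]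
  obtain ⟨s, hs⟩ := exists_imposesIndependent_of_residual (q := q) (c := fun j => (α j)⁻¹ * β j)
    (q' := fun j => v (.inl (true, b j)) ⨯₃ d) hz hres (fun x => dot_cross_self _ _)
    (imposesIndependent_of_card_le (fun x => hvl x.1) hww (by
      rw [Fintype.card_coe, hW]
      omega)) (fun j => by simp [q, π])
    (fun j => mul_ne_zero (inv_ne_zero (hα j)) (hβ j)) fun j => hld _
  let v' : Bool × ι → Fin 3 → k := fun x =>
    if x.2 = x₀ then if x.1 then l + s • d else l else v (.inl x)
  have hv' : ∀ σ, ∀ x ∈ A, v' (σ, x) = v (.inl (σ, x)) := fun σ x hx =>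
    if_neg fun h : x = x₀ => hx₀ (h ▸ hx)
  have hmem : ∀ x ∈ A, c x ≠ c x₀ → (x, x₀) ∈ bicolored c (insert x₀ A) := fun x hx h =>
    mem_bicolored.2 ⟨⟨mem_insert_of_mem hx, mem_insert_self _ _⟩, h⟩
  refine ⟨v', T ⊕ (W ⊕ Fin m), inferInstance, Sum.elim e
    (Sum.elim (fun x => (x.1.1, x.1.2, x₀)) fun j => (true, b j, x₀)), ?_, ?_, ?_⟩
  · rintro (t | x | j)
    · have := mem_bicolored.1 (he t)
      exact mem_bicolored.2 ⟨⟨mem_insert_of_mem this.1.1, mem_insert_of_mem this.1.2⟩, this.2⟩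
    · exact hmem _ (hS _ (hWS x)).1 (hS _ (hWS x)).2
    · exact hmem _ (hb' j).1 (hb' j).2
  · simp only [Fintype.card_sum, Fintype.card_coe, Fintype.card_fin, hN, hW]
    omega
  · rw [card_insert_of_notMem hx₀]
    convert hs using 1
    ext (t | x | j) : 1
    · have := mem_bicolored.1 (he t)
      simp only [Sum.elim_inl, hv' _ _ this.1.1, hv' _ _ this.1.2, z]
    · obtain ⟨⟨σ, x⟩, hx⟩ := x
      simp only [Sum.elim_inr, Sum.elim_inl, hv' _ _ (hS _ (hWS ⟨_, hx⟩)).1, w, q]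
      cases σ <;> simp [v']
    · simp only [Sum.elim_inr, hv' _ _ (hb' j).1, w, π, hαl, smul_smul]
      rw [mul_right_comm, inv_mul_cancel₀ (hα j), one_mul, ← hβl]
      simp [v']

end Horace

section MaximalRank

variable {ι κ : Type} [DecidableEq κ]

theorem card_bicolored [DecidableEq ι] (c : ι → κ) (A : Finset ι) (i : κ) :
    #(bicolored c A) =
      2 * (#{x ∈ A | c x = i} * #{x ∈ A | c x ≠ i}) + #(bicolored c {x ∈ A | c x ≠ i}) := by
  have h : bicolored c A = (({x ∈ A | c x = i} ×ˢ {x ∈ A | c x ≠ i}) ∪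
      ({x ∈ A | c x ≠ i} ×ˢ {x ∈ A | c x = i})) ∪ bicolored c {x ∈ A | c x ≠ i} := by
    ext ⟨x, y⟩
    simp only [mem_union, mem_product, mem_filter, mem_bicolored]
    by_cases hx : c x = i <;> by_cases hy : c y = i <;> simp [hx, hy, Ne.symm]
  rw [h, card_union_of_disjoint, card_union_of_disjoint, card_product, card_product]
  · ring
  · rw [Finset.disjoint_left]
    rintro ⟨x, y⟩ h h'
    simp only [mem_product, mem_filter] at h h'
    exact h'.1.2 h.1.2
  · rw [Finset.disjoint_left]
    rintro ⟨x, y⟩ h h'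
    simp only [mem_union, mem_product, mem_filter, mem_bicolored] at h h'
    rcases h with h | h
    exacts [h'.1.1.2 h.1.2, h'.1.2.2 h.2.2]

theorem card_bicolored_eq_zero (c : ι → κ) {A : Finset ι} (hA : #A ≤ 1) : #(bicolored c A) = 0 := by
  rw [Finset.card_eq_zero, Finset.eq_empty_iff_forall_notMem]
  intro p hp
  obtain ⟨⟨h1, h2⟩, h⟩ := mem_bicolored.1 hp
  exact h (congrArg c (Finset.card_le_one.1 hA _ h1 _ h2))

theorem mul_card_le_card_bicolored (c : ι → κ) (A : Finset ι) {s : ℕ}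
    (hs : ∀ i, s ≤ #{x ∈ A | c x ≠ i}) : #A * s ≤ #(bicolored c A) := by
  rw [bicolored, Finset.card_filter, Finset.sum_product, ← smul_eq_mul]
  refine Finset.card_nsmul_le_sum _ _ _ fun x _ => ?_
  rw [← Finset.card_filter]
  simpa only [ne_eq, eq_comm] using hs (c x)

variable {k : Type*} [Field k]

theorem hasIndependentNodes [Infinite k] [Finite ι] [DecidableEq ι] (c : ι → κ) (A : Finset ι)
    (hA : ∀ i, #{x ∈ A | c x ≠ i} ≤ #{x ∈ A | c x = i} → #(bicolored c A) ≤
      2 * (#{x ∈ A | c x = i} * #{x ∈ A | c x ≠ i}) + 3 * #{x ∈ A | c x ≠ i}) :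
    HasIndependentNodes k c A (min #(bicolored c A) ((#A + 2).choose 2)) := by
  obtain ⟨n, hn⟩ : ∃ n, #A = n := ⟨_, rfl⟩
  induction n generalizing A with
  | zero =>
    obtain rfl := Finset.card_eq_zero.1 hn
    refine ⟨0, Empty, inferInstance, Empty.elim, fun t => t.elim, ?_, Empty.elim,
      fun t => t.elim, fun t => t.elim, fun t => t.elim⟩
    rw [card_bicolored_eq_zero c (by simp)]
    simp
  | succ n ih =>
    obtain ⟨x₀, hxA, hmax⟩ := Finset.exists_max_image A (fun x => #{y ∈ A | c y = c x})
      (Finset.card_pos.1 (by omega))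
    obtain ⟨A, hx₀, rfl⟩ : ∃ A', x₀ ∉ A' ∧ insert x₀ A' = A :=
      ⟨A.erase x₀, notMem_erase _ _, insert_erase hxA⟩
    rw [card_insert_of_notMem hx₀, Nat.succ_inj] at hn
    have heq : #{x ∈ insert x₀ A | c x = c x₀} = #{x ∈ A | c x = c x₀} + 1 := by
      rw [filter_insert, if_pos rfl, card_insert_of_notMem (by simp [hx₀])]
    have hne : {x ∈ insert x₀ A | c x ≠ c x₀} = {x ∈ A | c x ≠ c x₀} := by
      rw [filter_insert, if_neg (by simp)]
    have heq' : ∀ i, i ≠ c x₀ → {x ∈ insert x₀ A | c x = i} = {x ∈ A | c x = i} := fun i hi => by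
      rw [filter_insert, if_neg hi.symm]
    have hsum : ∀ (B : Finset ι) i, #{x ∈ B | c x = i} + #{x ∈ B | c x ≠ i} = #B := fun B i =>
      Finset.card_filter_add_card_filter_not _
    have hle : ∀ i, #{x ∈ insert x₀ A | c x = i} ≤ #{x ∈ A | c x = c x₀} + 1 := by
      intro i
      by_cases h : ∃ x ∈ insert x₀ A, c x = i
      · obtain ⟨x, hx, rfl⟩ := h
        exact (hmax x hx).trans heq.le
      · rw [Finset.filter_eq_empty_iff.2 fun x hx hxi => h ⟨x, hx, hxi⟩]
        simp
    have hV := card_bicolored c (insert x₀ A) (c x₀)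
    have hV' := card_bicolored c A (c x₀)
    have hH := hA (c x₀)
    have hlow := mul_card_le_card_bicolored c (insert x₀ A) (s := #{x ∈ A | c x ≠ c x₀}) fun i => by
      have h1 := hsum (insert x₀ A) i
      have h2 := hsum (insert x₀ A) (c x₀)
      have h3 := hle i
      rw [hne] at h2
      omega
    rw [hne, heq] at hV hH
    rw [card_insert_of_notMem hx₀, hn] at hlow
    have hdn := hsum A (c x₀)
    rw [hn] at hdn
    have hIH := ih A (fun i hi => ?_) hn
    · have hC : 2 * (n + 2).choose 2 = (n + 2) * (n + 1) := by
        rw [mul_comm, ← Nat.add_one_mul_choose_eq (n + 1) 1, Nat.choose_one_right]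
      have hC' : (n + 1 + 2).choose 2 = (n + 2).choose 2 + (n + 2) := by
        rw [show n + 1 + 2 = (n + 2) + 1 from rfl, Nat.choose_succ_succ' (n + 2) 1,
          Nat.choose_one_right, add_comm]
      rw [card_insert_of_notMem hx₀, hn, hC']
      rw [hn] at hIH
      generalize #{x ∈ A | c x = c x₀} = d at *
      generalize hs : #{x ∈ A | c x ≠ c x₀} = s at *
      generalize hVA : #(bicolored c A) = V' at *
      generalize hCn : (n + 2).choose 2 = C at *
      have hVV : #(bicolored c (insert x₀ A)) = V' + 2 * s := by
        rw [hV, hV']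
        ring
      rw [hVV] at hlow hH ⊢
      have hsmall : 2 * s ≤ n + 1 → V' ≤ C := by
        intro h
        have := hH (by omega)
        obtain ⟨t, ht⟩ := Nat.exists_eq_add_of_le (show s ≤ d + 1 by omega)
        rw [show n + 2 = 2 * s + t + 1 by omega, show n + 1 = 2 * s + t by omega] at hC
        rw [ht] at this
        nlinarith [Nat.zero_le (t * t)]
      have hm2 : min (2 * s - (n + 2)) (C - V') ≤ 2 := by
        by_contra! h
        have h1 : n + 5 ≤ 2 * s := by omega
        have h2 : V' + 3 ≤ C := by omega
        nlinarith
      have := hIH.add_line hx₀ hm2 (by omega) fun h => by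
        rw [hs, hVA, hn, hCn]
        refine ⟨by omega, by omega, fun i => ?_, by omega⟩
        have h1 := hle i
        have h2 : #{x ∈ A | c x = i} ≤ #{x ∈ insert x₀ A | c x = i} :=
          card_le_card (filter_subset_filter _ (subset_insert _ _))
        omega
      rw [hs, hn] at this
      convert this using 1
      omega
    · by_cases hi0 : i = c x₀
      · subst hi0
        have := hH (by omega)
        nlinarith
      · have h1 := card_bicolored c A i
        have h2 := card_bicolored c {x ∈ A | c x ≠ i} (c x₀)
        have h3 := hsum {x ∈ A | c x ≠ i} (c x₀)
        have h4 : {x ∈ {x ∈ A | c x ≠ i} | c x = c x₀} = {x ∈ A | c x = c x₀} := by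
          rw [filter_filter]
          exact filter_congr fun x _ => ⟨And.right, fun h => ⟨h ▸ Ne.symm hi0, h⟩⟩
        have h5 := hle i
        rw [heq' i hi0] at h5
        rw [h4] at h2 h3
        have hq : #{x ∈ {x ∈ A | c x ≠ i} | c x ≠ c x₀} ≤ 1 := by omega
        rw [card_bicolored_eq_zero c hq] at h2
        nlinarith

end MaximalRank

section GradedDimension

variable {k : Type*} [Field k]

theorem MvPolynomial.IsHomogeneous.of_mul_left {f g : MvPolynomial (Fin 3) k} {m n : ℕ}
    (hf : f.IsHomogeneous m) (hf0 : f ≠ 0) (h : (f * g).IsHomogeneous (m + n)) :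
    g.IsHomogeneous n := by
  let _ : GradedAlgebra (homogeneousSubmodule (Fin 3) k) := MvPolynomial.gradedAlgebra
  have h1 := DirectSum.coe_decompose_mul_of_left_mem_of_le (homogeneousSubmodule (Fin 3) k)
    (b := g) hf (Nat.le_add_right m n)
  have h2 := DirectSum.decompose_of_mem_same (homogeneousSubmodule (Fin 3) k) h
  rw [h2, Nat.add_sub_cancel_left] at h1
  rw [mul_left_cancel₀ hf0 h1]
  exact ((DirectSum.decompose (homogeneousSubmodule (Fin 3) k)) g n).2

/-- The degree-`n` homogeneous part of the ideal `I`. -/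
noncomputable def gradedPart (I : Ideal (MvPolynomial (Fin 3) k)) (n : ℕ) :
    Submodule k (MvPolynomial (Fin 3) k) :=
  Submodule.restrictScalars k I ⊓ homogeneousSubmodule (Fin 3) k n

instance finite_gradedPart (I : Ideal (MvPolynomial (Fin 3) k)) (n : ℕ) :
    Module.Finite k (gradedPart I n) :=
  Submodule.finiteDimensional_inf_right _ _

theorem gradedDim_mono {I J : Ideal (MvPolynomial (Fin 3) k)} (h : I ≤ J) (n : ℕ) :
    gradedDim I n ≤ gradedDim J n :=
  have := finite_gradedPart J n
  Submodule.finrank_mono (t := gradedPart J n) (inf_le_inf_right _ h)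

theorem gradedDim_top (n : ℕ) :
    gradedDim (⊤ : Ideal (MvPolynomial (Fin 3) k)) n = (n + 2).choose 2 := by
  rw [gradedDim, Submodule.restrictScalars_top, top_inf_eq, finrank_homogeneousSubmodule]

theorem gradedDim_add_le (I J : Ideal (MvPolynomial (Fin 3) k)) (n : ℕ) :
    gradedDim I n + gradedDim J n ≤ gradedDim (I ⊓ J) n + (n + 2).choose 2 := by
  have h := Submodule.finrank_sup_add_finrank_inf_eq (gradedPart I n) (gradedPart J n)
  have h1 : gradedPart I n ⊓ gradedPart J n = gradedPart (I ⊓ J) n := by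
    rw [gradedPart, gradedPart, ← inf_inf_distrib_right]
    rfl
  have h2 : Module.finrank k ↥(gradedPart I n ⊔ gradedPart J n) ≤ (n + 2).choose 2 := by
    rw [← finrank_homogeneousSubmodule (k := k)]
    exact Submodule.finrank_mono (sup_le inf_le_right inf_le_right)
  rw [h1] at h
  change _ = gradedDim I n + gradedDim J n at h
  change _ + gradedDim (I ⊓ J) n = _ at h
  omega

theorem choose_le_gradedDim_finset_inf {ι : Type*} (s : Finset ι)
    (I : ι → Ideal (MvPolynomial (Fin 3) k)) (e : ι → ℕ) (n : ℕ)
    (h : ∀ i ∈ s, (n + 2).choose 2 ≤ gradedDim (I i) n + e i) :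
    (n + 2).choose 2 ≤ gradedDim (s.inf I) n + ∑ i ∈ s, e i := by
  classical
  induction s using Finset.induction_on with
  | empty => simp [gradedDim_top]
  | insert i s hi ih =>
    rw [Finset.inf_insert, Finset.sum_insert hi]
    have h1 := ih fun j hj => h j (mem_insert_of_mem hj)
    have h2 := h i (mem_insert_self _ _)
    have h3 := gradedDim_add_le (I i) (s.inf I) n
    omega

theorem finrank_map_mulLeft {f : MvPolynomial (Fin 3) k} (hf : f ≠ 0) (n : ℕ) :
    Module.finrank k ((homogeneousSubmodule (Fin 3) k n).map (LinearMap.mulLeft k f)) =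
      (n + 2).choose 2 := by
  rw [← finrank_homogeneousSubmodule (k := k)]
  exact (Submodule.equivMapOfInjective _ (fun _ _ h => mul_left_cancel₀ hf h) _).finrank_eq.symm

/-- A complete intersection of type `(a, b)` imposes at most `a * b` conditions. -/
theorem choose_le_gradedDim_span_pair {F G : MvPolynomial (Fin 3) k} {a b n : ℕ} (hF : F ≠ 0)
    (hG : G ≠ 0) (hFa : F.IsHomogeneous a) (hGb : G.IsHomogeneous b) (hFG : IsRelPrime F G)
    (hn : a + b ≤ n) :
    (n + 2).choose 2 ≤ gradedDim (Ideal.span {F, G}) n + a * b := by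
  obtain ⟨m, rfl⟩ := Nat.exists_eq_add_of_le hn
  set A := (homogeneousSubmodule (Fin 3) k (b + m)).map (LinearMap.mulLeft k F) with hA
  set B := (homogeneousSubmodule (Fin 3) k (a + m)).map (LinearMap.mulLeft k G) with hB
  have h := Submodule.finrank_sup_add_finrank_inf_eq A B
  have hAB : Module.finrank k ↥(A ⊓ B) ≤ (m + 2).choose 2 := by
    rw [← finrank_map_mulLeft (mul_ne_zero hF hG) m]
    refine Submodule.finrank_mono ?_
    rintro _ ⟨⟨u, hu, rfl⟩, w, hw, huw⟩
    simp only [LinearMap.mulLeft_apply] at huw ⊢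
    obtain ⟨q, rfl⟩ := hFG.symm.dvd_of_dvd_mul_left (Dvd.intro w huw)
    exact ⟨q, hGb.of_mul_left hG hu, mul_assoc F G q⟩
  have hsup : Module.finrank k ↥(A ⊔ B) ≤ gradedDim (Ideal.span {F, G}) (a + b + m) := by
    refine Submodule.finrank_mono (t := gradedPart _ _) (sup_le ?_ ?_)
    · rintro _ ⟨u, hu, rfl⟩
      refine ⟨Ideal.mul_mem_right _ _ (Ideal.subset_span (by simp)), ?_⟩
      rw [add_assoc]
      exact hFa.mul hu
    · rintro _ ⟨u, hu, rfl⟩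
      refine ⟨Ideal.mul_mem_right _ _ (Ideal.subset_span (by simp)), ?_⟩
      rw [add_comm a b, add_assoc]
      exact hGb.mul hu
  rw [finrank_map_mulLeft hF, finrank_map_mulLeft hG] at h
  have hC : ∀ t, 2 * (t + 2).choose 2 = (t + 2) * (t + 1) := fun t => by
    rw [mul_comm, ← Nat.add_one_mul_choose_eq (t + 1) 1, Nat.choose_one_right]
  nlinarith [hC (b + m), hC (a + m), hC m, hC (a + b + m)]

end GradedDimension

section LineArrangement

open scoped Matrix

variable {k : Type*} [Field k]

theorem linForm_ne_zero_of_ne_zero {v : Fin 3 → k} (hv : v ≠ 0) : linForm v ≠ 0 := by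
  obtain ⟨u, hu⟩ := exists_dotProduct_ne_zero hv
  exact linForm_ne_zero (p := u) (by rwa [dotProduct_comm])

theorem irreducible_linForm {v : Fin 3 → k} (hv : v ≠ 0) : Irreducible (linForm v) := by
  have h0 := linForm_ne_zero_of_ne_zero hv
  refine irreducible_of_totalDegree_eq_one ((isHomogeneous_linForm v).totalDegree h0)
    fun x hx => ?_
  obtain ⟨i, hi⟩ := exists_coeff_ne_zero h0
  exact (ne_zero_of_dvd_ne_zero hi (hx i)).isUnit

theorem isRelPrime_linForm {v w : Fin 3 → k} (h : v ⨯₃ w ≠ 0) :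
    IsRelPrime (linForm v) (linForm w) := by
  have hv : v ≠ 0 := by
    rintro rfl
    simp at h
  rw [(irreducible_linForm hv).isRelPrime_iff_not_dvd]
  rintro ⟨q, hq⟩
  obtain ⟨u, hu⟩ := exists_dotProduct_ne_zero h
  have := congrArg (eval (v ⨯₃ u)) hq
  rw [map_mul, eval_linForm, eval_linForm, dot_self_cross, zero_mul,
    triple_product_permutation, triple_product_permutation, ← cross_anticomm, dotProduct_neg,
    neg_eq_zero] at this
  exact hu this

theorem choose_le_gradedDim_idealOfForms {r : ℕ} {d : Fin r → ℕ}
    {F : Fin r → MvPolynomial (Fin 3) k} (h0 : ∀ i, F i ≠ 0) (hd : ∀ i, (F i).IsHomogeneous (d i))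
    (hF : ∀ i j, i ≠ j → IsRelPrime (F i) (F j)) :
    ((∑ i, d i) + 2).choose 2 ≤ gradedDim (idealOfForms F) (∑ i, d i) + Dval d := by
  refine (choose_le_gradedDim_finset_inf {q : Fin r × Fin r | q.1 < q.2}
    (fun q => Ideal.span {F q.1, F q.2}) (fun q => d q.1 * d q.2) _ fun q hq => ?_).trans
    (Nat.add_le_add_right (gradedDim_mono ?_ _) _)
  · have hne : q.1 ≠ q.2 := (mem_filter.1 hq).2.ne
    refine choose_le_gradedDim_span_pair (h0 _) (h0 _) (hd _) (hd _) (hF _ _ hne) ?_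
    rw [← sum_pair hne]
    exact sum_le_sum_of_subset (subset_univ _)
  · exact le_iInf fun i => le_iInf fun j => le_iInf fun hij =>
      Finset.inf_le (f := fun q : Fin r × Fin r => Ideal.span {F q.1, F q.2}) (b := (i, j))
        (by simpa using hij)

theorem eval_eq_zero_of_mem_idealOfForms {r : ℕ} {F : Fin r → MvPolynomial (Fin 3) k}
    {f : MvPolynomial (Fin 3) k} (hf : f ∈ idealOfForms F) {i j : Fin r} (hij : i ≠ j)
    {p : Fin 3 → k} (hi : eval p (F i) = 0) (hj : eval p (F j) = 0) : eval p f = 0 := by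
  wlog h : i < j generalizing i j
  · exact this hij.symm hj hi (hij.lt_or_gt.resolve_left h)
  simp only [idealOfForms, Ideal.mem_iInf] at hf
  obtain ⟨a, b, rfl⟩ := Ideal.mem_span_pair.1 (hf i j h)
  simp [hi, hj]

theorem gradedDim_add_card_le {I : Ideal (MvPolynomial (Fin 3) k)} {n : ℕ} {T : Type*} [Fintype T]
    {P : T → Fin 3 → k} (hP : ImposesIndependent n P) (hI : ∀ f ∈ I, ∀ t, eval (P t) f = 0) :
    gradedDim I n + Fintype.card T ≤ (n + 2).choose 2 := by
  rw [← hP.finrank_ker, ← Submodule.finrank_map_subtype_eq]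
  refine Nat.add_le_add_right (Submodule.finrank_mono ?_) _
  rintro f ⟨hf, hfn⟩
  refine ⟨⟨f, hfn⟩, ?_, rfl⟩
  ext t
  exact (evalForms_apply _ t).trans (hI f hf t)

variable {r : ℕ} {d : Fin r → ℕ}

/-- The forms cutting out the unions of lines of each colour. -/
noncomputable def lineForms (u : (Σ i, Fin (d i)) → Fin 3 → k) (i : Fin r) :
    MvPolynomial (Fin 3) k :=
  ∏ x, linForm (u ⟨i, x⟩)

theorem isHomogeneous_lineForms (u : (Σ i, Fin (d i)) → Fin 3 → k) (i : Fin r) :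
    (lineForms u i).IsHomogeneous (d i) := by
  simpa [lineForms] using IsHomogeneous.prod univ (fun x => linForm (u ⟨i, x⟩)) (fun _ => 1)
    fun x _ => isHomogeneous_linForm _

theorem lineForms_ne_zero {u : (Σ i, Fin (d i)) → Fin 3 → k} (hu : ∀ x, u x ≠ 0) (i : Fin r) :
    lineForms u i ≠ 0 :=
  prod_ne_zero_iff.2 fun _ _ => linForm_ne_zero_of_ne_zero (hu _)

theorem isRelPrime_lineForms {u : (Σ i, Fin (d i)) → Fin 3 → k}
    (hu : ∀ x y, x ≠ y → u x ⨯₃ u y ≠ 0) (i j : Fin r) (hij : i ≠ j) :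
    IsRelPrime (lineForms u i) (lineForms u j) :=
  IsRelPrime.prod_left fun _ _ => IsRelPrime.prod_right fun _ _ =>
    isRelPrime_linForm (hu _ _ fun h => hij (congrArg Sigma.fst h))

theorem eval_lineForms_eq_zero {u : (Σ i, Fin (d i)) → Fin 3 → k} {p : Fin 3 → k}
    {x : Σ i, Fin (d i)} (h : u x ⬝ᵥ p = 0) : eval p (lineForms u x.1) = 0 := by
  rw [lineForms, map_prod]
  exact prod_eq_zero (mem_univ x.2) (by rw [eval_linForm]; exact h)

end LineArrangement

section Counting

variable {r : ℕ} (d : Fin r → ℕ)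

theorem card_sigma_fst (p : Fin r → Prop) [DecidablePred p] :
    #({x | p x.1} : Finset (Σ i, Fin (d i))) = ∑ i with p i, d i := by
  have : ({x | p x.1} : Finset (Σ i, Fin (d i))) =
      ({i | p i} : Finset (Fin r)).sigma fun _ => univ := by
    ext x
    simp
  simp [this]

theorem card_bicolored_sigma (p : Fin r → Prop) [DecidablePred p] :
    #(bicolored Sigma.fst ({x | p x.1} : Finset (Σ i, Fin (d i)))) =
      2 * ∑ q : Fin r × Fin r with q.1 < q.2 ∧ p q.1 ∧ p q.2, d q.1 * d q.2 := by
  have h1 : #(bicolored Sigma.fst ({x | p x.1} : Finset (Σ i, Fin (d i)))) =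
      ∑ q : Fin r × Fin r with q.1 ≠ q.2 ∧ p q.1 ∧ p q.2, d q.1 * d q.2 := by
    rw [card_eq_sum_card_fiberwise (f := fun z => (z.1.1, z.2.1))
      (t := {q : Fin r × Fin r | q.1 ≠ q.2 ∧ p q.1 ∧ p q.2}) ?_]
    · refine sum_congr rfl fun q hq => ?_
      have h3 : {z ∈ bicolored Sigma.fst ({x | p x.1} : Finset (Σ i, Fin (d i))) |
          (z.1.1, z.2.1) = q} = ({x | x.1 = q.1} : Finset (Σ i, Fin (d i))) ×ˢ
            ({x | x.1 = q.2} : Finset (Σ i, Fin (d i))) := by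
        ext z
        simp only [mem_filter, mem_univ, true_and, mem_bicolored, mem_product, Prod.ext_iff] at hq ⊢
        refine ⟨And.right, fun h => ⟨?_, h⟩⟩
        rw [h.1, h.2]
        exact ⟨hq.2, hq.1⟩
      rw [h3, card_product, card_sigma_fst d (· = q.1), card_sigma_fst d (· = q.2)]
      simp [filter_eq']
    · intro z hz
      simp only [coe_filter, mem_coe, mem_bicolored, mem_filter, mem_univ, true_and,
        Set.mem_ofPred_eq] at hz ⊢
      exact ⟨hz.2, hz.1⟩
  have h2 : ∑ q : Fin r × Fin r with q.2 < q.1 ∧ p q.1 ∧ p q.2, d q.1 * d q.2 =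
      ∑ q : Fin r × Fin r with q.1 < q.2 ∧ p q.1 ∧ p q.2, d q.1 * d q.2 :=
    sum_bij' (fun q _ => q.swap) (fun q _ => q.swap) (by simp; tauto) (by simp; tauto) (by simp)
      (by simp) (by simp [mul_comm])
  rw [h1, two_mul]
  nth_rw 2 [← h2]
  rw [← sum_union]
  · congr 1
    ext q
    simp only [mem_filter, mem_univ, true_and, mem_union, ne_iff_lt_or_gt]
    tauto
  · rw [disjoint_filter]
    intro q _ h h'
    exact lt_asymm h.1 h'.1

theorem card_bicolored_univ :
    #(bicolored Sigma.fst (univ : Finset (Σ i, Fin (d i)))) = 2 * Dval d := by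
  simpa [Dval] using card_bicolored_sigma d fun _ => True

variable [NeZero r]

theorem card_bicolored_ne_zero :
    #(bicolored Sigma.fst ({x | x.1 ≠ 0} : Finset (Σ i, Fin (d i)))) = 2 * pval d := by
  rw [card_bicolored_sigma d (· ≠ 0), pval]
  congr 1
  refine sum_congr (filter_congr fun q _ => ?_) fun _ _ => rfl
  rw [Fin.val_ne_zero_iff]
  exact ⟨fun h => ⟨h.1, h.2.1⟩, fun h => ⟨h.1, h.2, ((Fin.zero_le _).trans_lt h.1).ne'⟩⟩

theorem card_sigma_ne_zero : #({x | x.1 ≠ 0} : Finset (Σ i, Fin (d i))) = sval d := by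
  rw [card_sigma_fst d (· ≠ 0), sval]
  simp only [Fin.val_ne_zero_iff]

theorem card_bicolored_le (hanti : ∀ i, d i ≤ d 0)
    (h : ¬ (sval d ≤ d 0 ∧ 3 * sval d < 2 * pval d)) (i : Fin r)
    (hi : #({x | x.1 ≠ i} : Finset (Σ i, Fin (d i))) ≤ #({x | x.1 = i} : Finset (Σ i, Fin (d i)))) :
    #(bicolored Sigma.fst (univ : Finset (Σ i, Fin (d i)))) ≤
      2 * (#({x | x.1 = i} : Finset (Σ i, Fin (d i))) *
        #({x | x.1 ≠ i} : Finset (Σ i, Fin (d i)))) +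
        3 * #({x | x.1 ≠ i} : Finset (Σ i, Fin (d i))) := by
  have hcard : ∀ j, #({x | x.1 = j} : Finset (Σ i, Fin (d i))) = d j := fun j => by
    rw [card_sigma_fst d (· = j)]
    simp [filter_eq']
  rw [card_bicolored Sigma.fst univ i]
  by_cases hi0 : i = 0
  · subst hi0
    rw [hcard, card_sigma_ne_zero] at hi
    rw [hcard, card_sigma_ne_zero, card_bicolored_ne_zero]
    omega
  · have h1 := card_bicolored Sigma.fst ({x | x.1 ≠ i} : Finset (Σ i, Fin (d i))) 0
    have h2 := card_filter_add_card_filter_not (s := ({x | x.1 ≠ i} : Finset (Σ i, Fin (d i))))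
      (fun x => x.1 = 0)
    have h3 : #{x ∈ ({x | x.1 ≠ i} : Finset (Σ i, Fin (d i))) | x.1 = 0} = d 0 := by
      rw [← hcard 0, filter_filter]
      exact congrArg card (filter_congr fun x _ =>
        ⟨And.right, fun h => ⟨h ▸ Ne.symm hi0, h⟩⟩)
    have h4 : #{x ∈ ({x | x.1 ≠ i} : Finset (Σ i, Fin (d i))) | x.1 ≠ 0} = 0 := by
      have := hanti i
      rw [hcard i] at hi
      simp only [ne_eq] at *
      omega
    rw [card_bicolored_eq_zero Sigma.fst (h4.trans_le zero_le_one), h4] at h1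
    omega

end Counting

section Main

open scoped Matrix

theorem exists_forms_gradedDim_eq {k : Type*} [Field k] [Infinite k] {r : ℕ} [NeZero r]
    (d : Fin r → ℕ) (hanti : ∀ i, d i ≤ d 0)
    (h : ¬ (sval d ≤ d 0 ∧ 3 * sval d < 2 * pval d)) :
    ∃ F G : Fin r → MvPolynomial (Fin 3) k,
      (∀ i, F i ≠ 0 ∧ (F i).IsHomogeneous (d i)) ∧
      (∀ i, G i ≠ 0 ∧ (G i).IsHomogeneous (d i)) ∧
      gradedDim (idealOfForms F ⊓ idealOfForms G) (∑ i, d i) =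
        ((∑ i, d i) + 2).choose 2 - 2 * Dval d := by
  obtain ⟨v, T, _, e, hv, he, hcard, hT⟩ := (hasIndependentNodes (k := k) Sigma.fst
    (univ : Finset (Σ i, Fin (d i))) (card_bicolored_le d hanti h)).exists_inGeneralPosition
  have hn : #(univ : Finset (Σ i, Fin (d i))) = ∑ i, d i := by simp
  rw [hn, card_bicolored_univ] at hcard
  rw [hn] at hT
  set u : Bool → (Σ i, Fin (d i)) → Fin 3 → k := fun b x => v (.inl (b, x)) with hu
  have hcross : ∀ b x y, x ≠ y → u b x ⨯₃ u b y ≠ 0 := fun b x y hxy =>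
    hv.cross_ne_zero (.inr 0) (by simp [hxy])
  have hu0 : ∀ b x, u b x ≠ 0 := fun b x h0 => by
    have := hv.cross_ne_zero (x := .inl (b, x)) (y := .inr 0) (.inr 1) (by simp)
    rw [show v (.inl (b, x)) = 0 from h0] at this
    simp at this
  have hprop : ∀ b i, lineForms (u b) i ≠ 0 ∧ (lineForms (u b) i).IsHomogeneous (d i) :=
    fun b i => ⟨lineForms_ne_zero (hu0 b) i, isHomogeneous_lineForms _ i⟩
  refine ⟨lineForms (u false), lineForms (u true), hprop _, hprop _, ?_⟩
  have hlow : ∀ b, _ := fun b => choose_le_gradedDim_idealOfForms (fun i => (hprop b i).1)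
    (fun i => (hprop b i).2) (isRelPrime_lineForms (hcross b))
  have h1 := hlow false
  have h2 := hlow true
  have h3 := gradedDim_add_le (idealOfForms (lineForms (u false)))
    (idealOfForms (lineForms (u true))) (∑ i, d i)
  have h4 := gradedDim_add_card_le hT
    (I := idealOfForms (lineForms (u false)) ⊓ idealOfForms (lineForms (u true))) fun f hf t => by
      have hf' : ∀ b, f ∈ idealOfForms (lineForms (u b)) := by
        rintro (_ | _)
        exacts [hf.1, hf.2]
      exact eval_eq_zero_of_mem_idealOfForms (hf' (e t).1) (mem_bicolored.1 (he t)).2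
        (eval_lineForms_eq_zero (dot_self_cross _ _))
        (eval_lineForms_eq_zero (dot_cross_self _ _))
  omega

end Main

/-- Nondefective direction of the Main Theorem: if it is not the case that both
`d₁ ≥ s` and `2p - 3s > 0`, then for general `[F], [G] ∈ X_{2,λ}` the space
`(I_F ∩ I_G)_d` has the expected dimension `max {0, C(d+2,2) - 2D}`. -/
theorem secant_line_variety_nondefective_case
    {k : Type*} [Field k] [IsAlgClosed k]
    (r : ℕ) [NeZero r] (hr : 2 ≤ r)
    (d : Fin r → ℕ)
    (hanti : ∀ i j : Fin r, i ≤ j → d j ≤ d i)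
    (hpos : ∀ i, 1 ≤ d i)
    (h : ¬ (sval d ≤ d 0 ∧ 3 * sval d < 2 * pval d)) :
    ∃ F G : Fin r → MvPolynomial (Fin 3) k,
      (∀ i, F i ≠ 0 ∧ (F i).IsHomogeneous (d i)) ∧
      (∀ i, G i ≠ 0 ∧ (G i).IsHomogeneous (d i)) ∧
      (gradedDim (idealOfForms F ⊓ idealOfForms G) (∑ i, d i) : ℤ) =
        max 0 ((((∑ i, d i) + 2).choose 2 : ℤ) - 2 * Dval d) := by
  obtain ⟨F, G, hF, hG, hFG⟩ :=
    exists_forms_gradedDim_eq (k := k) d (fun i => hanti 0 i (Fin.zero_le i)) h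
  refine ⟨F, G, hF, hG, ?_⟩
  rw [hFG]
  omega
end

section
/- Let k be an algebraically closed field and let r ≥ 2 and d₁ ≥ d₂ ≥ ⋯ ≥ d_r ≥ 1 be integers with d₁ ≥ s, where s = d₂+⋯+d_r and d = d₁+⋯+d_r. Then for EVERY choice of nonzero homogeneous polynomials F₁,…,F_r, G₁,…,G_r ∈ k[x₀,x₁,x₂] with deg F_i = deg G_i = d_i one has dim_k (I_F ∩ I_G)_d ≥ C(d−2s+2, 2) = C(d₁−s+2, 2). (Key step in Lemma 4.10: the form F₂⋯F_r·G₂⋯G_r of degree 2s lies in I_F ∩ I_G, and its multiples by all forms of degree d−2s give C(d₁−s+2,2) independent elements of (I_F ∩ I_G)_d.) -/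
open MvPolynomial Finset

theorem prod_mem_idealOfForms {k : Type*} [Field k] {r : ℕ}
    (F : Fin r → MvPolynomial (Fin 3) k) :
    ∏ i ∈ univ.filter (fun i : Fin r => i.val ≠ 0), F i ∈ idealOfForms F := by
  simp only [idealOfForms, Submodule.mem_iInf]
  intro i j hij
  refine Ideal.mem_of_dvd _ (dvd_prod_of_mem F (a := j) ?_)
    (Ideal.subset_span (Set.mem_insert_of_mem _ rfl))
  have : i.val < j.val := hij
  simp only [mem_filter, mem_univ, true_and]
  omega

/-- The multiples of a nonzero form of degree `m` in a homogeneous ideal, by the monomials of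
degree `n`, bound the dimension of the degree-`(m + n)` part from below. -/
theorem choose_le_gradedDim_of_mem {k : Type*} [Field k]
    {I : Ideal (MvPolynomial (Fin 3) k)} {H : MvPolynomial (Fin 3) k} {m : ℕ}
    (hI : H ∈ I) (hH : H ≠ 0) (hm : H.IsHomogeneous m) (n : ℕ) :
    (n + 2).choose 2 ≤ gradedDim I (m + n) := by
  have hfin : Module.Finite k (homogeneousSubmodule (Fin 3) k (m + n)) :=
    Module.Finite.iff_fg.mpr (homogeneousSubmodule_fg _ _ _)
  have hfin' : Module.Finite k
      ↥(Submodule.restrictScalars k I ⊓ homogeneousSubmodule (Fin 3) k (m + n)) :=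
    Submodule.finiteDimensional_of_le inf_le_right
  let v : (univ : Finset (Fin 3)).finsuppAntidiag n →
      ↥(Submodule.restrictScalars k I ⊓ homogeneousSubmodule (Fin 3) k (m + n)) :=
    fun e => ⟨H * monomial e.1 1, I.mul_mem_right _ hI, hm.mul (isHomogeneous_monomial _ (by
      rw [Finsupp.degree_eq_sum]
      exact (mem_finsuppAntidiag.mp e.2).1))⟩
  have hv : LinearIndependent k v := by
    refine LinearIndependent.of_comp (Submodule.subtype _) ?_
    have hbasis := ((basisMonomials (Fin 3) k).linearIndependent.comp
      (Subtype.val : (univ : Finset (Fin 3)).finsuppAntidiag n → _)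
      Subtype.val_injective).map' (LinearMap.mulLeft k H)
      (LinearMap.ker_eq_bot.mpr (mul_right_injective₀ hH))
    have hcomp : (Submodule.subtype _ ∘ v) =
        (LinearMap.mulLeft k H ∘ basisMonomials (Fin 3) k ∘ Subtype.val) := by
      funext e
      simp [v]
    rw [hcomp]
    exact hbasis
  have hcard := hv.fintype_card_le_finrank
  rw [Fintype.card_coe, card_finsuppAntidiag_nat_eq_choose, card_univ, Fintype.card_fin,
    show 3 + n - 1 = n + 2 by omega, Nat.choose_symm_add] at hcard
  exact hcard

theorem sum_eq_add_sval {r : ℕ} [NeZero r] (d : Fin r → ℕ) : ∑ i, d i = d 0 + sval d := by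
  rw [sval, ← add_sum_erase univ d (mem_univ 0)]
  congr 2
  ext i
  simp only [mem_erase, mem_univ, and_true, mem_filter, true_and, ne_eq, Fin.ext_iff, Fin.val_zero]

/-- Key step of Lemma 4.10: if `d₁ ≥ s` then for every choice of nonzero forms of the
given degrees, `dim (I_F ∩ I_G)_d ≥ C(d - 2s + 2, 2) = C(d₁ - s + 2, 2)`. -/
theorem lower_bound_unbalanced
    {k : Type*} [Field k] [IsAlgClosed k]
    (r : ℕ) [NeZero r] (hr : 2 ≤ r)
    (d : Fin r → ℕ)
    (hanti : ∀ i j : Fin r, i ≤ j → d j ≤ d i)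
    (hpos : ∀ i, 1 ≤ d i)
    (hds : sval d ≤ d 0) :
    (∀ F G : Fin r → MvPolynomial (Fin 3) k,
      (∀ i, F i ≠ 0 ∧ (F i).IsHomogeneous (d i)) →
      (∀ i, G i ≠ 0 ∧ (G i).IsHomogeneous (d i)) →
      ((∑ i, d i) + 2 - 2 * sval d).choose 2 ≤
        gradedDim (idealOfForms F ⊓ idealOfForms G) (∑ i, d i)) ∧
    ((∑ i, d i) + 2 - 2 * sval d).choose 2 = (d 0 + 2 - sval d).choose 2 := by
  have hsum := sum_eq_add_sval d
  refine ⟨fun F G hF hG => ?_, by congr 1; omega⟩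
  have hmem : (∏ i ∈ univ.filter (fun i : Fin r => i.val ≠ 0), F i) *
      (∏ i ∈ univ.filter (fun i : Fin r => i.val ≠ 0), G i) ∈ idealOfForms F ⊓ idealOfForms G :=
    ⟨Ideal.mul_mem_right _ _ (prod_mem_idealOfForms F),
      Ideal.mul_mem_left _ _ (prod_mem_idealOfForms G)⟩
  have hdim := choose_le_gradedDim_of_mem hmem
    (mul_ne_zero (prod_ne_zero_iff.mpr fun i _ => (hF i).1)
      (prod_ne_zero_iff.mpr fun i _ => (hG i).1))
    ((IsHomogeneous.prod _ F d fun i _ => (hF i).2).mul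
      (IsHomogeneous.prod _ G d fun i _ => (hG i).2)) (d 0 - sval d)
  change _ ≤ gradedDim _ (sval d + sval d + (d 0 - sval d)) at hdim
  convert hdim using 2 <;> omega
end
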